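/- arXiv:1001.0902 — 7 statements merged into one kernel-verified Lean document; each statement's English description precedes it below -/
import Mathlib

section
/- Let $R$ be a commutative ring and let $x_1,\dots,x_n$ be a regular sequence in $R$ (so each $x_k$ is a nonzerodivisor on $R/(x_1,\dots,x_{k-1})$ and the ideal $(x_1,\dots,x_n)$ is proper). Then for every natural number $i$ with $i \neq n$, the Ext group $\mathrm{Ext}^i_R(R/(x_1,\dots,x_n),\, R)$ is zero. -/
open CategoryTheory MvPolynomial

open RingTheory.Sequence

universe u v

/-- If `Ext` computed in the derived category vanishes, so does `Ext` computed as a derived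
functor. -/
lemma isZero_Ext_of_subsingleton_abelianExt {R : Type*} [Ring R] {C : Type u} [Category.{v} C]
    [Abelian C] [Linear R C] [EnoughProjectives C] [HasExt C] (X Y : C) (i : ℕ)
    (h : Subsingleton (Abelian.Ext X Y i)) :
    Limits.IsZero (((Ext R C i).obj (Opposite.op X)).obj Y) := by
  let P := ProjectiveResolution.of X
  refine Limits.IsZero.of_iso ?_ (P.isoExt i Y)
  rw [← HomologicalComplex.exactAt_iff_isZero_homology]
  cases i with
  | zero =>
    rw [HomologicalComplex.exactAt_iff' _ 0 0 1 (by simp) (by simp),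
      ShortComplex.moduleCat_exact_iff]
    intro (f : P.complex.X 0 ⟶ Y) (hf : P.complex.d 1 0 ≫ f = 0)
    have : Subsingleton (X ⟶ Y) := Abelian.Ext.homEquiv₀.subsingleton_congr.mp h
    obtain rfl : f = 0 := by
      have hdesc : P.exact₀.desc f hf = (0 : X ⟶ Y) := Subsingleton.elim (α := X ⟶ Y) _ _
      rw [← P.exact₀.g_desc f hf, hdesc]
      exact Limits.comp_zero
    exact ⟨0, map_zero _⟩
  | succ p =>
    rw [HomologicalComplex.exactAt_iff' _ p (p + 1) (p + 2) (by simp) (by simp),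
      ShortComplex.moduleCat_exact_iff]
    intro (f : P.complex.X (p + 1) ⟶ Y) (hf : P.complex.d (p + 2) (p + 1) ≫ f = 0)
    exact (P.extMk_eq_zero_iff f (p + 2) rfl hf p rfl).mp (Subsingleton.elim _ _)

namespace ModuleCat

variable {R : Type u} [CommRing R]

/-- If `rs` is weakly regular on `M` and annihilates `N`, then `Ext^i(N, M) = 0` for all
`i < rs.length`. -/
lemma subsingleton_ext_of_isWeaklyRegular_of_mem_annihilator [Small.{v} R]
    (N M : ModuleCat.{v} R) (rs : List R) (reg : IsWeaklyRegular M rs)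
    (hN : ∀ r ∈ rs, r ∈ Module.annihilator R N) (i : ℕ) (hi : i < rs.length) :
    Subsingleton (Abelian.Ext N M i) := by
  induction rs generalizing M i with
  | nil => simp at hi
  | cons a rs ih =>
    rw [isWeaklyRegular_cons_iff] at reg
    simp only [List.mem_cons, forall_eq_or_imp] at hN
    cases i with
    | zero =>
      have : Subsingleton (N →ₗ[R] M) := by
        refine subsingleton_of_forall_eq 0 fun f ↦ LinearMap.ext fun y ↦ reg.1 ?_
        simp [← map_smul, Module.mem_annihilator.mp hN.1 y]
      exact (Abelian.Ext.addEquiv₀.trans ModuleCat.homAddEquiv).subsingleton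
    | succ i =>
      have h := ih (ModuleCat.of R (QuotSMulTop a M)) reg.2 hN.2 i (by simpa using hi)
      have : Mono (AddCommGrpCat.ofHom
          ((Abelian.Ext.mk₀ (a • 𝟙 M)).postcomp N (add_zero (i + 1)))) :=
        (Abelian.Ext.covariant_sequence_exact₁' N reg.1.smulShortComplex_shortExact i (i + 1)
          rfl).mono_g ((AddCommGrpCat.isZero_of_iff_subsingleton.mpr h).eq_zero_of_src _)
      exact AddCommGrpCat.subsingleton_of_isZero <| Limits.IsZero.of_mono_eq_zero _
        (Abelian.Ext.postcomp_smul_id_eq_zero_of_mem_annihilator hN.1 (i + 1))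

/-- Passing to the quotient by a weakly regular sequence of length `n` raises the projective
dimension by at most `n`. -/
lemma hasProjectiveDimensionLT_quotient_of_isWeaklyRegular (M : ModuleCat.{v} R) (rs : List R)
    (reg : IsWeaklyRegular M rs) (k : ℕ) [HasProjectiveDimensionLT M k] :
    HasProjectiveDimensionLT (ModuleCat.of R (M ⧸ Ideal.ofList rs • (⊤ : Submodule R M)))
      (k + rs.length) := by
  induction rs generalizing M k with
  | nil =>
    exact hasProjectiveDimensionLT_of_iso
      (Submodule.quotEquivOfEqBot _ (by simp)).symm.toModuleIso k
  | cons a rs ih =>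
    rw [isWeaklyRegular_cons_iff] at reg
    have : HasProjectiveDimensionLT (ModuleCat.of R (QuotSMulTop a M)) (k + 1) :=
      reg.1.smulShortComplex_shortExact.hasProjectiveDimensionLT_X₃ k ‹_›
        (hasProjectiveDimensionLT_of_ge M k (k + 1) k.le_succ)
    have := ih (ModuleCat.of R (QuotSMulTop a M)) reg.2 (k + 1)
    rw [List.length_cons, add_comm rs.length, ← add_assoc]
    exact hasProjectiveDimensionLT_of_iso
      (Submodule.quotOfListConsSMulTopEquivQuotSMulTopInner M a rs).symm.toModuleIso _

end ModuleCat

/-- If `x₁, …, xₙ` is a regular sequence in a commutative ring `R`, then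
`Ext^i_R(R/(x₁, …, xₙ), R) = 0` for all `i ≠ n`. -/
theorem ext_vanishes_off_degree_of_isRegular_sequence
    (R : Type) [CommRing R] (n : ℕ) (x : Fin n → R)
    (hreg : RingTheory.Sequence.IsRegular R (List.ofFn x))
    (i : ℕ) (hi : i ≠ n) :
    Subsingleton
      (((Ext R (ModuleCat R) i).obj
          (Opposite.op (ModuleCat.of R (R ⧸ Ideal.span (Set.range x))))).obj
        (ModuleCat.of R R)) := by
  have hspan : Ideal.ofList (List.ofFn x) = Ideal.span (Set.range x) := by
    simp [Ideal.ofList, List.mem_ofFn, Set.range]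
  refine ModuleCat.subsingleton_of_isZero (isZero_Ext_of_subsingleton_abelianExt _ _ i ?_)
  obtain hlt | hgt := hi.lt_or_gt
  · refine ModuleCat.subsingleton_ext_of_isWeaklyRegular_of_mem_annihilator _ _ (List.ofFn x)
      hreg.toIsWeaklyRegular (fun r hr ↦ ?_) i (by simpa using hlt)
    rw [Ideal.annihilator_quotient, ← hspan]
    exact Ideal.subset_span hr
  · have := ModuleCat.hasProjectiveDimensionLT_quotient_of_isWeaklyRegular (ModuleCat.of R R)
      (List.ofFn x) hreg.toIsWeaklyRegular 1
    have : HasProjectiveDimensionLT (ModuleCat.of R (R ⧸ Ideal.span (Set.range x)))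
        (1 + (List.ofFn x).length) :=
      hasProjectiveDimensionLT_of_iso
        (Submodule.quotEquivOfEq (Ideal.ofList (List.ofFn x) • (⊤ : Ideal R)) _
          (by rw [hspan, smul_eq_mul, Ideal.mul_top])).toModuleIso _
    exact HasProjectiveDimensionLT.subsingleton _ (1 + (List.ofFn x).length) i
      (by rw [List.length_ofFn]; omega) _
end

section
/- Let $R$ be a commutative ring and let $x_1,\dots,x_n$ be a regular sequence in $R$ (so each $x_k$ is a nonzerodivisor on $R/(x_1,\dots,x_{k-1})$ and the ideal $(x_1,\dots,x_n)$ is proper). Then the Ext group $\mathrm{Ext}^n_R(R/(x_1,\dots,x_n),\, R)$ is nonzero. In particular, the projective dimension of the $R$-module $R/(x_1,\dots,x_n)$ is at least $n$. -/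
open CategoryTheory

/-- An object of an abelian category has projective dimension at most `n` if it admits a
projective resolution of length at most `n`, i.e. a projective resolution whose terms vanish
in degrees greater than `n`. -/
def HasProjDimLE {C : Type*} [Category C] [Abelian C] (X : C) (n : ℕ) : Prop :=
  ∃ P : ProjectiveResolution X, ∀ i : ℕ, n < i → Limits.IsZero (P.complex.X i)

universe v

open RingTheory.Sequence in
/-- If a module `N` is annihilated by a sequence that is weakly regular on `M`, then `Ext^i(N, M)`
vanishes in degrees below the length of the sequence. -/
lemma ModuleCat.subsingleton_ext_of_isWeaklyRegular {R : Type*} [CommRing R] [Small.{v} R]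
    (N : ModuleCat.{v} R) (rs : List R) (hN : ∀ r ∈ rs, r ∈ Module.annihilator R N)
    (M : ModuleCat.{v} R) (hM : IsWeaklyRegular M rs) (i : ℕ) (hi : i < rs.length) :
    Subsingleton (Abelian.Ext N M i) := by
  induction rs generalizing M i with
  | nil => simp at hi
  | cons r rs ih =>
    simp only [List.mem_cons, forall_eq_or_imp] at hN
    rw [isWeaklyRegular_cons_iff] at hM
    cases i with
    | zero =>
      have := hM.1.linearMap_subsingleton_of_mem_annihilator hN.1
      exact (Abelian.Ext.addEquiv₀.trans ModuleCat.homAddEquiv).subsingleton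
    | succ i =>
      have hsub := ih hN.2 (ModuleCat.of R (QuotSMulTop r M)) hM.2 i (by simpa using hi)
      have hmono := (Abelian.Ext.covariant_sequence_exact₁' N hM.1.smulShortComplex_shortExact
        i (i + 1) rfl).mono_g
          ((AddCommGrpCat.isZero_of_iff_subsingleton.mpr hsub).eq_zero_of_src _)
      exact AddCommGrpCat.subsingleton_of_isZero (@Limits.IsZero.of_mono_eq_zero _ _ _ _ _ _ hmono
        (Abelian.Ext.postcomp_smul_id_eq_zero_of_mem_annihilator hN.1 (i + 1)))

open RingTheory.Sequence in
/-- If a module `N` is annihilated by a sequence `rs` that is weakly regular on `M`, then a nonzero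
homomorphism `N → M / rs M` yields a nonzero class in `Ext(N, M)` in degree the length of `rs`. -/
lemma ModuleCat.nontrivial_ext_length_of_isWeaklyRegular {R : Type*} [CommRing R] [Small.{v} R]
    (N : ModuleCat.{v} R) (rs : List R) (hN : ∀ r ∈ rs, r ∈ Module.annihilator R N)
    (M : ModuleCat.{v} R) (hM : IsWeaklyRegular M rs)
    (hNM : Nontrivial (N →ₗ[R] M ⧸ (Ideal.ofList rs • ⊤ : Submodule R M))) :
    Nontrivial (Abelian.Ext N M rs.length) := by
  induction rs generalizing M with
  | nil =>
    let e : (M ⧸ (Ideal.ofList ([] : List R) • ⊤ : Submodule R M)) ≃ₗ[R] M :=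
      Submodule.quotEquivOfEqBot _ (by rw [Ideal.ofList_nil, Submodule.bot_smul])
    have := (LinearEquiv.congrRight (R := R) (M := N) e).symm.toEquiv.nontrivial
    exact (Abelian.Ext.addEquiv₀.trans ModuleCat.homAddEquiv).nontrivial
  | cons r rs ih =>
    have hsub := ModuleCat.subsingleton_ext_of_isWeaklyRegular N (r :: rs) hN M hM rs.length
      (by simp)
    simp only [List.mem_cons, forall_eq_or_imp] at hN
    rw [isWeaklyRegular_cons_iff] at hM
    have := (LinearEquiv.congrRight (R := R) (M := N)
      (Submodule.quotOfListConsSMulTopEquivQuotSMulTopInner M r rs)).symm.toEquiv.nontrivial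
    have hnon := ih hN.2 (ModuleCat.of R (QuotSMulTop r M)) hM.2 this
    have hmono := (Abelian.Ext.covariant_sequence_exact₃' N hM.1.smulShortComplex_shortExact
      rs.length (rs.length + 1) rfl).mono_g
        ((AddCommGrpCat.isZero_of_iff_subsingleton.mpr hsub).eq_zero_of_src _)
    have hinj := (AddCommGrpCat.mono_iff_injective _).mp hmono
    exact @Function.Injective.nontrivial _ _ hnon _ hinj

/-- Yoneda `Ext` vanishes wherever the `Ext` defined by left deriving `Hom` vanishes. -/
lemma CategoryTheory.Abelian.Ext.subsingleton_of_isZero_ext (R : Type*) [Ring R] {C : Type*}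
    [Category C] [Abelian C] [Linear R C] [EnoughProjectives C] [HasExt C] (X Y : C) (n : ℕ)
    (h : Limits.IsZero (((_root_.Ext R C n).obj (Opposite.op X)).obj Y)) :
    Subsingleton (Abelian.Ext X Y n) := by
  let P := projectiveResolution X
  have hex : (P.complex.linearYonedaObj R Y).ExactAt n := by
    rw [HomologicalComplex.exactAt_iff_isZero_homology]
    exact h.of_iso (P.isoExt n Y).symm
  refine subsingleton_of_forall_eq 0 fun α ↦ ?_
  obtain ⟨f, hf, rfl⟩ := P.extMk_surjective α (n + 1) rfl
  cases n with
  | zero =>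
    rw [HomologicalComplex.exactAt_iff' _ 0 0 1 (by simp) (by simp),
      ShortComplex.moduleCat_exact_iff] at hex
    obtain ⟨g, hg⟩ := hex f hf
    have hf0 : f = 0 := by
      rw [← hg]
      simp
      rfl
    subst hf0
    exact P.extMk_zero _ _
  | succ p =>
    rw [HomologicalComplex.exactAt_iff' _ p (p + 1) (p + 2) (by simp) (by simp),
      ShortComplex.moduleCat_exact_iff] at hex
    obtain ⟨g, hg⟩ := hex f hf
    exact (P.extMk_eq_zero_iff f _ _ hf p rfl).mpr ⟨g, hg⟩

/-- `Ext^n(X, Y)` vanishes in degrees above the projective dimension of `X`. -/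
lemma HasProjDimLE.isZero_ext (R : Type*) [Ring R] {C : Type*} [Category C] [Abelian C]
    [Linear R C] [EnoughProjectives C] {X : C} {m n : ℕ} (hX : HasProjDimLE X m) (hmn : m < n)
    (Y : C) : Limits.IsZero (((Ext R C n).obj (Opposite.op X)).obj Y) := by
  obtain ⟨P, hP⟩ := hX
  refine Limits.IsZero.of_iso ?_ (P.isoExt n Y)
  rw [← HomologicalComplex.exactAt_iff_isZero_homology, HomologicalComplex.exactAt_iff]
  refine ShortComplex.exact_of_isZero_X₂ _ ?_
  rw [Limits.IsZero.iff_id_eq_zero]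
  ext (f : _ ⟶ _)
  exact (hP n hmn).eq_of_src _ _

/-- If `x₁, …, xₙ` is a regular sequence in a commutative ring `R`, then
`Ext^n_R(R/(x₁, …, xₙ), R) ≠ 0`; in particular the projective dimension of the `R`-module
`R/(x₁, …, xₙ)` is at least `n`. -/
theorem ext_nonzero_in_top_degree_of_isRegular_sequence
    (R : Type) [CommRing R] (n : ℕ) (x : Fin n → R)
    (hreg : RingTheory.Sequence.IsRegular R (List.ofFn x)) :
    Nontrivial
      (((Ext R (ModuleCat R) n).obj
          (Opposite.op (ModuleCat.of R (R ⧸ Ideal.span (Set.range x))))).obj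
        (ModuleCat.of R R)) ∧
    ∀ m : ℕ, HasProjDimLE (ModuleCat.of R (R ⧸ Ideal.span (Set.range x))) m → n ≤ m := by
  have hI : Ideal.ofList (List.ofFn x) = Ideal.span (Set.range x) := by
    rw [Ideal.ofList]
    congr 1
    ext r
    simp
  have hquot : (Ideal.ofList (List.ofFn x) • ⊤ : Submodule R R) = Ideal.span (Set.range x) := by
    rw [hI]
    simp
  have : Nontrivial (R ⧸ Ideal.span (Set.range x)) :=
    Ideal.Quotient.nontrivial_iff.mpr fun h ↦ hreg.top_ne_smul (hquot.trans h).symm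
  have hnon : Nontrivial (Abelian.Ext (ModuleCat.of R (R ⧸ Ideal.span (Set.range x)))
      (ModuleCat.of R R) n) := by
    have := ModuleCat.nontrivial_ext_length_of_isWeaklyRegular
      (ModuleCat.of R (R ⧸ Ideal.span (Set.range x))) (List.ofFn x)
      (fun r hr ↦ by
        rw [Ideal.annihilator_quotient]
        exact Ideal.subset_span ((List.mem_ofFn' x r).mp hr))
      (ModuleCat.of R R) hreg.toIsWeaklyRegular
      ⟨(Submodule.quotEquivOfEq _ _ hquot.symm).toLinearMap, 0, fun h ↦ by
        obtain ⟨y, hy⟩ := exists_ne (0 : R ⧸ Ideal.span (Set.range x))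
        exact hy ((Submodule.quotEquivOfEq _ _ hquot.symm).map_eq_zero_iff.mp
          (LinearMap.congr_fun h y))⟩
    rwa [List.length_ofFn] at this
  have hzero : ¬ Limits.IsZero (((Ext R (ModuleCat R) n).obj
      (Opposite.op (ModuleCat.of R (R ⧸ Ideal.span (Set.range x))))).obj (ModuleCat.of R R)) :=
    fun h ↦ not_subsingleton_iff_nontrivial.mpr hnon
      (Abelian.Ext.subsingleton_of_isZero_ext R _ _ n h)
  refine ⟨?_, fun m hm ↦ ?_⟩
  · rwa [ModuleCat.isZero_iff_subsingleton, not_subsingleton_iff_nontrivial] at hzero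
  · by_contra! hmn
    exact hzero (hm.isZero_ext R hmn _)
end

section
/- Let $R$ be a ring and let $X$ be an object of the derived category $D(R)$ of right $R$-modules. Then every homology module $H_n(X)$ ($n \in \mathbb{Z}$) is a projective right $R$-module if and only if every ghost morphism in $D(R)$ with domain $X$ is zero. -/
open CategoryTheory

universe w

/-- A morphism in the derived category is a *ghost* if it induces the zero map on all
homology objects. -/
def IsGhost {C : Type*} [Category C] [Abelian C] [HasDerivedCategory.{w} C]
    {X Y : DerivedCategory C} (f : X ⟶ Y) : Prop :=
  ∀ n : ℤ, (DerivedCategory.homologyFunctor C n).map f = 0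

open Limits HomologicalComplex

section ZeroDifferential

variable {C : Type*} [Category C] [Abelian C]

variable {K L : CochainComplex C ℤ}

lemma CochainComplex.isIso_iCycles_of_d_eq_zero (hd : ∀ i j, K.d i j = 0) (n : ℤ) :
    IsIso (K.iCycles n) :=
  K.isIso_iCycles n _ rfl (hd _ _)

/-- A family of maps from projective objects to the homology of `K` is realised by a morphism
from a complex of projective objects with zero differential. -/
lemma CochainComplex.exists_homologyMap_eq_of_projective
    (K : CochainComplex C ℤ) (P : ℤ → C) (hP : ∀ n, Projective (P n))
    (q : ∀ n, P n ⟶ K.homology n) :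
    ∃ (K' : CochainComplex C ℤ) (s : K' ⟶ K) (e : ∀ n, P n ≅ K'.homology n),
      (∀ i j, K'.d i j = 0) ∧ (∀ n, Projective (K'.X n)) ∧
        ∀ n, (e n).hom ≫ homologyMap s n = q n := by
  let K' : CochainComplex C ℤ := { X := P, d := fun _ _ ↦ 0 }
  have hd : ∀ i j, K'.d i j = 0 := fun _ _ ↦ rfl
  let t (n : ℤ) : P n ⟶ K.cycles n := Projective.factorThru (q n) (K.homologyπ n)
  have ht (n : ℤ) : t n ≫ K.homologyπ n = q n := Projective.factorThru_comp _ _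
  let s : K' ⟶ K :=
    { f := fun n ↦ t n ≫ K.iCycles n
      comm' := fun i j _ ↦ by rw [hd, zero_comp, Category.assoc, iCycles_d, comp_zero] }
  have hs (n : ℤ) : (K'.iCyclesIso n _ rfl (hd _ _)).inv ≫ cyclesMap s n = t n := by
    rw [← cancel_mono (K.iCycles n), Category.assoc, cyclesMap_i, iCyclesIso_inv_hom_id_assoc]
  refine ⟨K', s, fun n ↦ (K'.iCyclesIso n _ rfl (hd _ _)).symm ≪≫
    K'.isoHomologyπ _ n rfl (hd _ _), hd, hP, fun n ↦ ?_⟩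
  rw [Iso.trans_hom, Iso.symm_hom, isoHomologyπ_hom, Category.assoc, homologyπ_naturality,
    reassoc_of% hs, ht]

/-- A morphism of complexes which is zero on homology is null-homotopic when its source
has zero differential and projective terms. -/
lemma CochainComplex.nonempty_homotopy_zero_of_homologyMap_eq_zero (hd : ∀ i j, K.d i j = 0)
    [∀ n, Projective (K.X n)] (φ : K ⟶ L) (hφ : ∀ n, homologyMap φ n = 0) :
    Nonempty (Homotopy φ 0) := by
  have lift (i j : ℤ) (hij : (ComplexShape.up ℤ).Rel j i) :
      ∃ h : K.X i ⟶ L.X j, h ≫ L.d j i = φ.f i := by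
    have := isIso_iCycles_of_d_eq_zero hd i
    have hexact := ShortComplex.exact_of_g_is_cokernel
      (ShortComplex.mk _ _ (L.toCycles_comp_homologyπ j i))
      (L.homologyIsCokernel j i ((ComplexShape.up ℤ).prev_eq' hij))
    have hzero : (inv (K.iCycles i) ≫ cyclesMap φ i) ≫ L.homologyπ i = 0 := by
      rw [Category.assoc, ← homologyπ_naturality, hφ, comp_zero, comp_zero]
    refine ⟨hexact.liftFromProjective _ hzero, ?_⟩
    have h := hexact.liftFromProjective_comp _ hzero
    dsimp at h
    rw [← L.toCycles_i, reassoc_of% h, cyclesMap_i, IsIso.inv_hom_id_assoc]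
  choose h hh using lift
  classical
  refine ⟨{ hom i j := if hij : (ComplexShape.up ℤ).Rel j i then h i j hij else 0
            zero i j hij := dif_neg hij
            comm i := ?_ }⟩
  have hrel : (ComplexShape.up ℤ).Rel (i - 1) i := by simp
  have hrel' : (ComplexShape.up ℤ).Rel i (i + 1) := by simp
  rw [prevD_eq _ hrel, dNext_eq _ hrel', hd, zero_comp, dif_pos hrel, hh]
  simp

end ZeroDifferential

namespace DerivedCategory

variable {C : Type*} [Category C] [Abelian C] [HasDerivedCategory.{w} C]

/-- The functor `homologyFunctor C n` sends `Q.map φ` to `homologyMap φ n`, up to isomorphism. -/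
noncomputable def homologyFunctorMapQArrowIso {K L : CochainComplex C ℤ} (φ : K ⟶ L) (n : ℤ) :
    Arrow.mk ((homologyFunctor C n).map (Q.map φ)) ≅ Arrow.mk (homologyMap φ n) :=
  Arrow.isoMk ((homologyFunctorFactors C n).app K) ((homologyFunctorFactors C n).app L)
    (homologyFunctorFactors_hom_naturality φ n).symm

lemma homologyMap_eq_zero_of_isGhost {K L : CochainComplex C ℤ} (φ : K ⟶ L)
    (hφ : IsGhost (Q.map φ)) (n : ℤ) : homologyMap φ n = 0 := by
  have h : ((homologyFunctorFactors C n).app K).hom ≫ homologyMap φ n = 0 :=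
    (homologyFunctorFactors_hom_naturality φ n).symm.trans
      ((congrArg (· ≫ _) (hφ n)).trans zero_comp)
  exact ((Iso.eq_inv_comp _).2 h).trans comp_zero

lemma eq_zero_of_isGhost_of_d_eq_zero {K : CochainComplex C ℤ} (hd : ∀ i j, K.d i j = 0)
    [∀ n, Projective (K.X n)] {Y : DerivedCategory C} (f : Q.obj K ⟶ Y) (hf : IsGhost f) :
    f = 0 := by
  let e := Q.objObjPreimageIso Y
  obtain ⟨L, g, s, _, hfac⟩ := left_fac (f ≫ e.inv)
  have hg : Q.map g = f ≫ e.inv ≫ Q.map s := by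
    rw [← Category.assoc, hfac, Category.assoc, IsIso.inv_hom_id, Category.comp_id]
  have hzero : ∀ n, homologyMap g n = 0 := homologyMap_eq_zero_of_isGhost g fun n ↦ by
    rw [hg, Functor.map_comp, hf n, zero_comp]
  obtain ⟨H⟩ := CochainComplex.nonempty_homotopy_zero_of_homologyMap_eq_zero hd g hzero
  rw [← cancel_mono e.inv, hfac, Q_map_eq_of_homotopy _ H, Functor.map_zero, zero_comp, zero_comp]

/-- If the homology of `X` is projective, then every ghost with domain `X` is zero. -/
theorem eq_zero_of_isGhost_of_projective_homology {X Y : DerivedCategory C}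
    (hX : ∀ n, Projective ((homologyFunctor C n).obj X)) (f : X ⟶ Y) (hf : IsGhost f) :
    f = 0 := by
  let K := Q.objPreimage X
  let e : Q.obj K ≅ X := Q.objObjPreimageIso X
  have (n : ℤ) : Projective (K.homology n) :=
    Projective.of_iso ((homologyFunctor C n).mapIso e.symm ≪≫
      (homologyFunctorFactors C n).app K) (hX n)
  obtain ⟨P, s, i, hd, _, hs⟩ :=
    K.exists_homologyMap_eq_of_projective (fun n ↦ K.homology n) this (fun _ ↦ 𝟙 _)
  have : QuasiIso s := by
    refine ⟨fun n ↦ ?_⟩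
    rw [quasiIsoAt_iff_isIso_homologyMap, (Iso.eq_inv_comp (i n)).2 (hs n)]
    infer_instance
  rw [← cancel_epi e.hom, ← cancel_epi (Q.map s), comp_zero, comp_zero]
  refine eq_zero_of_isGhost_of_d_eq_zero hd _ fun n ↦ ?_
  rw [Functor.map_comp, Functor.map_comp, hf n, comp_zero, comp_zero]

/-- If every ghost with domain `X` is zero, then the homology of `X` is projective. -/
theorem projective_homology_of_ghosts_eq_zero [EnoughProjectives C] {X : DerivedCategory C}
    (hX : ∀ (Y : DerivedCategory C) (f : X ⟶ Y), IsGhost f → f = 0) (n : ℤ) :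
    Projective ((homologyFunctor C n).obj X) := by
  let K := Q.objPreimage X
  let e : Q.obj K ≅ X := Q.objObjPreimageIso X
  obtain ⟨P, s, j, -, -, hs⟩ := K.exists_homologyMap_eq_of_projective
    (fun n ↦ Projective.over (K.homology n)) (fun _ ↦ inferInstance) (fun _ ↦ Projective.π _)
  have hepi (n : ℤ) : Epi ((homologyFunctor C n).map (Q.map s ≫ e.hom)) := by
    have : Epi (homologyMap s n) := by
      rw [(Iso.eq_inv_comp (j n)).2 (hs n)]
      infer_instance
    have : Epi ((homologyFunctor C n).map (Q.map s)) :=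
      ((MorphismProperty.epimorphisms C).arrow_iso_iff (homologyFunctorMapQArrowIso s n)).2 this
    rw [Functor.map_comp]
    infer_instance
  obtain ⟨Z, g, δ, hT⟩ := Pretriangulated.distinguished_cocone_triangle (Q.map s ≫ e.hom)
  have hg : g = 0 := hX Z g fun n ↦
    (HomologySequence.epi_homologyMap_mor₁_iff _ hT n).1 (hepi n)
  obtain ⟨i, hi⟩ := Pretriangulated.Triangle.coyoneda_exact₂ _ hT (𝟙 X)
    ((congrArg (𝟙 X ≫ ·) hg).trans comp_zero)
  have : Projective ((homologyFunctor C n).obj (Q.obj P)) :=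
    Projective.of_iso (j n ≪≫ ((homologyFunctorFactors C n).app P).symm) inferInstance
  have r : Retract X (Q.obj P) := { i := i, r := Q.map s ≫ e.hom, retract := hi.symm }
  exact (r.map (homologyFunctor C n)).projective

end DerivedCategory

/-- For an object `X` of the derived category of right `R`-modules, every homology
module `Hₙ(X)` is projective if and only if every ghost with domain `X` is zero. -/
theorem homology_projective_iff_ghosts_out_vanish
    (R : Type) [Ring R] [HasDerivedCategory.{w} (ModuleCat Rᵐᵒᵖ)]
    (X : DerivedCategory (ModuleCat Rᵐᵒᵖ)) :
    (∀ n : ℤ, Projective ((DerivedCategory.homologyFunctor (ModuleCat Rᵐᵒᵖ) n).obj X)) ↔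
      ∀ (Y : DerivedCategory (ModuleCat Rᵐᵒᵖ)) (f : X ⟶ Y), IsGhost f → f = 0 := by
  exact ⟨fun h _ f hf ↦ DerivedCategory.eq_zero_of_isGhost_of_projective_homology h f hf,
    fun h ↦ DerivedCategory.projective_homology_of_ghosts_eq_zero h⟩
end

section
/- Let $R$ be a ring and let $X$ be an object of the derived category $D(R)$ of right $R$-modules. Then every homology module $H_n(X)$ ($n \in \mathbb{Z}$) is an injective right $R$-module if and only if every ghost morphism in $D(R)$ with codomain $X$ is zero. -/
open CategoryTheory

universe w

section

universe v u

open Limits HomologicalComplex Pretriangulated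

namespace HomologicalComplex

variable {C : Type*} [Category C] [Abelian C] {ι : Type*} {c : ComplexShape ι}

/-- The homology of a complex with zero differentials is given by its terms. -/
noncomputable def homologyIsoXOfDEqZero (L : HomologicalComplex C c)
    (hL : ∀ i j, L.d i j = 0) (n : ι) : L.homology n ≅ L.X n :=
  L.isoHomologyι n _ rfl (hL _ _) ≪≫ (L.pOpcyclesIso _ n rfl (hL _ _)).symm

/-- Any family of morphisms on homology is induced by a morphism of complexes if the target
has zero differentials and injective terms. -/
lemma exists_homologyMap_eq {A L : HomologicalComplex C c} (hL : ∀ i j, L.d i j = 0)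
    [∀ n, Injective (L.X n)] (φ : ∀ n, A.homology n ⟶ L.homology n) :
    ∃ f : A ⟶ L, ∀ n, homologyMap f n = φ n := by
  let f : A ⟶ L :=
    { f := fun n ↦ A.pOpcycles n ≫
        Injective.factorThru (φ n ≫ (L.homologyIsoXOfDEqZero hL n).hom) (A.homologyι n)
      comm' := fun i j _ ↦ by simp [hL] }
  refine ⟨f, fun n ↦ ?_⟩
  have := L.isIso_homologyι n _ rfl (hL _ _)
  have hf : opcyclesMap f n =
      Injective.factorThru (φ n ≫ (L.homologyIsoXOfDEqZero hL n).hom) (A.homologyι n) ≫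
        L.pOpcycles n := by
    rw [← cancel_epi (A.pOpcycles n), p_opcyclesMap]
    simp [f]
  rw [← cancel_mono (L.homologyι n), homologyι_naturality, hf, Injective.comp_factorThru_assoc]
  simp [homologyIsoXOfDEqZero]

/-- Morphisms from the homology of `K` to injective objects `I n` are realized by a morphism
from `K` to the complex with terms `I n` and zero differentials. -/
lemma exists_hom_d_eq_zero (K : HomologicalComplex C c) (I : ι → C) [hI : ∀ n, Injective (I n)]
    (φ : ∀ n, K.homology n ⟶ I n) :
    ∃ (L : HomologicalComplex C c) (p : K ⟶ L) (e : ∀ n, L.homology n ≅ I n),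
      (∀ i j, L.d i j = 0) ∧ (∀ n, Injective (L.X n)) ∧
        ∀ n, homologyMap p n = φ n ≫ (e n).inv := by
  let L : HomologicalComplex C c := { X := I, d := fun _ _ ↦ 0 }
  have hL (i j : ι) : L.d i j = 0 := rfl
  have : ∀ n, Injective (L.X n) := hI
  let e (n : ι) : L.homology n ≅ I n := L.homologyIsoXOfDEqZero hL n
  obtain ⟨p, hp⟩ := exists_homologyMap_eq hL fun n ↦ φ n ≫ (e n).inv
  exact ⟨L, p, e, hL, hI, hp⟩

end HomologicalComplex

namespace CochainComplex

variable {C : Type*} [Category C] [Abelian C]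

/-- A morphism inducing zero on homology is null-homotopic if its target has zero differentials
and injective terms. -/
lemma nonempty_homotopy_zero_of_homologyMap_eq_zero_s3 {A L : CochainComplex C ℤ}
    (hL : ∀ i j, L.d i j = 0) [∀ n, Injective (L.X n)] (f : A ⟶ L)
    (hf : ∀ n, homologyMap f n = 0) : Nonempty (Homotopy f 0) := by
  have hi (n : ℤ) : A.iCycles n ≫ f.f n = 0 := by
    have := L.isIso_homologyπ _ n rfl (hL _ _)
    have h : cyclesMap f n = 0 := by
      rw [← cancel_mono (L.homologyπ n), ← homologyπ_naturality, hf, comp_zero, zero_comp]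
    rw [← cyclesMap_i, h, zero_comp]
  have hs (i j : ℤ) (hij : i + 1 = j) : ∃ s : A.X j ⟶ L.X i, A.d i j ≫ s = f.f i := by
    have ex : (ShortComplex.mk (A.iCycles i) (A.d i j) (A.iCycles_d i j)).Exact :=
      ShortComplex.exact_of_f_is_kernel _ (A.cyclesIsKernel i j (by simp [hij]))
    exact ⟨ex.descToInjective (f.f i) (hi i), ex.comp_descToInjective _ _⟩
  choose s hs using hs
  exact ⟨{
    hom := fun j i ↦ if h : i + 1 = j then s i j h else 0
    zero := fun j i h ↦ dif_neg h
    comm := fun i ↦ by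
      rw [dNext_eq _ (show (ComplexShape.up ℤ).Rel i (i + 1) from rfl),
        prevD_eq _ (show (ComplexShape.up ℤ).Rel (i - 1) i from by simp)]
      simp [hL, hs] }⟩

lemma isKInjective_of_d_eq_zero {L : CochainComplex C ℤ} (hL : ∀ i j, L.d i j = 0)
    [∀ n, Injective (L.X n)] : L.IsKInjective where
  nonempty_homotopy_zero f hA := nonempty_homotopy_zero_of_homologyMap_eq_zero_s3 hL f
    fun n ↦ ((exactAt_iff_isZero_homology _ _).1 (hA n)).eq_of_src _ _

end CochainComplex

namespace DerivedCategory

variable {C : Type u} [Category.{v} C] [Abelian C] [HasDerivedCategory.{w} C]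

lemma homologyFunctor_map_Q_map_eq_zero_iff {K L : CochainComplex C ℤ} (f : K ⟶ L) (n : ℤ) :
    (homologyFunctor C n).map (Q.map f) = 0 ↔ homologyMap f n = 0 := by
  rw [← cancel_mono ((homologyFunctorFactors C n).hom.app L),
    homologyFunctorFactors_hom_naturality, zero_comp]
  exact Preadditive.IsIso.comp_left_eq_zero _ _

lemma exists_Q_map_eq_of_isKInjective {K L : CochainComplex C ℤ} [L.IsKInjective]
    (f : Q.obj K ⟶ Q.obj L) : ∃ g : K ⟶ L, Q.map g = f := by
  obtain ⟨g', hg'⟩ := (CochainComplex.IsKInjective.Qh_map_bijective _ L).2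
    ((quotientCompQhIso C).hom.app K ≫ f ≫ (quotientCompQhIso C).inv.app L)
  obtain ⟨g, rfl⟩ := (HomotopyCategory.quotient C (.up ℤ)).map_surjective g'
  refine ⟨g, ?_⟩
  rw [← cancel_epi ((quotientCompQhIso C).hom.app K), ← quotientCompQhIso_hom_naturality]
  erw [hg']
  simp

/-- A ghost whose codomain has injective homology is zero. -/
lemma eq_zero_of_isGhost {X Y : DerivedCategory C} (f : Y ⟶ X)
    [∀ n, Injective ((homologyFunctor C n).obj X)] (hf : IsGhost f) : f = 0 := by
  let K := Q.objPreimage X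
  let eX : Q.obj K ≅ X := Q.objObjPreimageIso X
  let A := Q.objPreimage Y
  let eY : Q.obj A ≅ Y := Q.objObjPreimageIso Y
  have hK (n : ℤ) : Injective (K.homology n) := Injective.of_iso
    ((homologyFunctor C n).mapIso eX.symm ≪≫ (homologyFunctorFactors C n).app K) inferInstance
  obtain ⟨L, p, e, hL, _, hp⟩ := exists_hom_d_eq_zero K (fun n ↦ K.homology n) fun n ↦ 𝟙 _
  have := CochainComplex.isKInjective_of_d_eq_zero hL
  have : QuasiIso p := ⟨fun n ↦ by
    rw [quasiIsoAt_iff_isIso_homologyMap, hp]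
    infer_instance⟩
  obtain ⟨g, hg⟩ := exists_Q_map_eq_of_isKInjective (eY.hom ≫ f ≫ eX.inv ≫ Q.map p)
  obtain ⟨h⟩ := CochainComplex.nonempty_homotopy_zero_of_homologyMap_eq_zero_s3 hL g fun n ↦ by
    rw [← homologyFunctor_map_Q_map_eq_zero_iff, hg]
    simp [hf n]
  have h0 := Q_map_eq_of_homotopy _ h
  rw [hg, Q.map_zero] at h0
  simpa using h0

/-- If every ghost with codomain `X` vanishes, then `X` has injective homology. -/
lemma injective_homology_of_ghosts_eq_zero [EnoughInjectives C] {X : DerivedCategory C}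
    (hX : ∀ (Y : DerivedCategory C) (f : Y ⟶ X), IsGhost f → f = 0) (n : ℤ) :
    Injective ((homologyFunctor C n).obj X) := by
  let K := Q.objPreimage X
  let eX : Q.obj K ≅ X := Q.objObjPreimageIso X
  obtain ⟨L, p, e, hL, _, hp⟩ := exists_hom_d_eq_zero K
    (fun n ↦ Injective.under (K.homology n)) fun n ↦ Injective.ι _
  let q : X ⟶ Q.obj L := eX.inv ≫ Q.map p
  have hq (n : ℤ) : Mono ((homologyFunctor C n).map q) := by
    have : Mono (homologyMap p n) := by
      rw [hp]
      infer_instance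
    have : Mono ((homologyFunctor C n).map (Q.map p)) := by
      have h := mono_comp' (g := (homologyFunctorFactors C n).hom.app K) inferInstance this
      rw [← homologyFunctorFactors_hom_naturality] at h
      exact @mono_of_mono _ _ _ _ _ _ _ h
    rw [Functor.map_comp]
    infer_instance
  obtain ⟨F, g, h, hT⟩ := distinguished_cocone_triangle₁ q
  have hg : g = 0 := hX F g fun m ↦ (HomologySequence.mono_homologyMap_mor₂_iff _ hT m).1 (hq m)
  obtain ⟨r, hr⟩ := Triangle.yoneda_exact₂ _ hT (𝟙 X) ((Category.comp_id g).trans hg)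
  have hLn : Injective ((homologyFunctor C n).obj (Q.obj L)) := Injective.of_iso
    ((homologyFunctorFactors C n).app L ≪≫ e n).symm inferInstance
  exact (Retract.map ⟨q, r, hr.symm⟩ (homologyFunctor C n)).injective

end DerivedCategory

end

/-- For an object `X` of the derived category of right `R`-modules, every homology
module `Hₙ(X)` is injective if and only if every ghost with codomain `X` is zero. -/
theorem homology_injective_iff_ghosts_in_vanish
    (R : Type) [Ring R] [HasDerivedCategory.{w} (ModuleCat Rᵐᵒᵖ)]
    (X : DerivedCategory (ModuleCat Rᵐᵒᵖ)) :
    (∀ n : ℤ, Injective ((DerivedCategory.homologyFunctor (ModuleCat Rᵐᵒᵖ) n).obj X)) ↔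
      ∀ (Y : DerivedCategory (ModuleCat Rᵐᵒᵖ)) (f : Y ⟶ X), IsGhost f → f = 0 := by
  exact ⟨fun _ _ f hf ↦ DerivedCategory.eq_zero_of_isGhost f hf,
    fun h n ↦ DerivedCategory.injective_homology_of_ghosts_eq_zero h n⟩
end

section
/- Let $R$ be a ring, let $n$ be a natural number, and let $X$ be an object of the derived category $D(R)$ of right $R$-modules such that every homology module $H_i(X)$ has projective dimension at most $n$ as a right $R$-module. Then for any sequence of $n+1$ ghost morphisms $X \xrightarrow{f_1} X_1 \xrightarrow{f_2} \cdots \xrightarrow{f_{n+1}} X_{n+1}$ in $D(R)$ starting at $X$, the composite $f_{n+1} \circ \cdots \circ f_1$ is zero. -/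
open CategoryTheory

universe w

/-- `IsGhostComposite f k` means that the morphism `f` in the derived category can be written
as a composite of `k` ghost morphisms. -/
inductive IsGhostComposite {C : Type*} [Category C] [Abelian C] [HasDerivedCategory.{w} C] :
    ∀ {X Y : DerivedCategory C}, (X ⟶ Y) → ℕ → Prop
  | single {X Y : DerivedCategory C} {f : X ⟶ Y} (h : IsGhost f) : IsGhostComposite f 1
  | comp {X Y Z : DerivedCategory C} {f : X ⟶ Y} {g : Y ⟶ Z} {k : ℕ}
      (hf : IsGhostComposite f k) (hg : IsGhost g) : IsGhostComposite (f ≫ g) (k + 1)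

open CategoryTheory Limits Pretriangulated

section

variable {C : Type*} [Category C] [Abelian C]

/-- A morphism inducing zero in homology from a complex of projective objects with zero
differentials is homotopic to zero. -/
lemma nonempty_homotopy_zero_of_homologyMap_eq_zero {K L : CochainComplex C ℤ}
    [∀ i, Projective (K.X i)] (hK : ∀ i j, K.d i j = 0) (f : K ⟶ L)
    (hf : ∀ i, HomologicalComplex.homologyMap f i = 0) : Nonempty (Homotopy f 0) := by
  have key (i j : ℤ) (hij : j + 1 = i) : ∃ h : K.X i ⟶ L.X j, h ≫ L.d j i = f.f i := by
    let S := ShortComplex.mk _ _ (L.toCycles_comp_homologyπ j i)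
    have hS : S.Exact := S.exact_of_g_is_cokernel
      (L.homologyIsCokernel j i (by rw [← hij]; simp))
    have : IsIso (K.iCycles i) := K.isIso_iCycles i _ rfl (hK _ _)
    let z : K.X i ⟶ L.cycles i := inv (K.iCycles i) ≫ HomologicalComplex.cyclesMap f i
    have hz : z ≫ S.g = 0 := by
      simp [z, S, ← HomologicalComplex.homologyπ_naturality, hf]
    refine ⟨hS.liftFromProjective z hz, ?_⟩
    have := hS.liftFromProjective_comp z hz
    rw [← L.toCycles_i j i]
    change _ ≫ S.f ≫ _ = _
    rw [reassoc_of% this]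
    simp [z]
  choose h hh using key
  classical
  refine ⟨{
    hom i j := if hij : j + 1 = i then h i j hij else 0
    zero i j hij := dif_neg hij
    comm i := ?_ }⟩
  rw [dNext_eq _ (show (ComplexShape.up ℤ).Rel i (i + 1) from rfl),
    prevD_eq _ (show (ComplexShape.up ℤ).Rel (i - 1) i by simp), hK]
  simp [hh]

/-- A complex of projective objects with zero differentials is K-projective. -/
lemma isKProjective_of_d_eq_zero {K : CochainComplex C ℤ}
    [∀ i, Projective (K.X i)] (hK : ∀ i j, K.d i j = 0) : K.IsKProjective where
  nonempty_homotopy_zero f hL :=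
    nonempty_homotopy_zero_of_homologyMap_eq_zero hK f
      (fun i ↦ (hL i).isZero_homology.eq_of_tgt _ _)

lemma exists_hom_homologyMap_eq {K L : CochainComplex C ℤ}
    [∀ i, Projective (K.X i)] (hK : ∀ i j, K.d i j = 0)
    (q : ∀ i, K.homology i ⟶ L.homology i) :
    ∃ f : K ⟶ L, ∀ i, HomologicalComplex.homologyMap f i = q i := by
  have (i : ℤ) : IsIso (K.iCycles i) := K.isIso_iCycles i _ rfl (hK _ _)
  let g (i : ℤ) : K.X i ⟶ L.cycles i :=
    Projective.factorThru (inv (K.iCycles i) ≫ K.homologyπ i ≫ q i) (L.homologyπ i)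
  have hg (i : ℤ) : g i ≫ L.homologyπ i = inv (K.iCycles i) ≫ K.homologyπ i ≫ q i :=
    Projective.factorThru_comp _ _
  let f : K ⟶ L := { f i := g i ≫ L.iCycles i }
  have hf (i : ℤ) : HomologicalComplex.cyclesMap f i = K.iCycles i ≫ g i := by
    rw [← cancel_mono (L.iCycles i)]
    simp [f]
  refine ⟨f, fun i ↦ ?_⟩
  rw [← cancel_epi (K.homologyπ i), HomologicalComplex.homologyπ_naturality, hf]
  simp [hg]

/-- The cochain complex with zero differentials attached to a family of objects. -/
def zeroDifferentialComplex (Q : ℤ → C) : CochainComplex C ℤ where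
  X := Q
  d _ _ := 0

/-- The homology of a complex with zero differentials. -/
noncomputable def zeroDifferentialComplexHomologyIso (Q : ℤ → C) (i : ℤ) :
    (zeroDifferentialComplex Q).homology i ≅ Q i :=
  ((zeroDifferentialComplex Q).isoHomologyπ _ i rfl rfl).symm ≪≫
    (zeroDifferentialComplex Q).iCyclesIso i _ rfl rfl

lemma CategoryTheory.ProjectiveResolution.hasProjectiveDimensionLE {X : C} (P : ProjectiveResolution X) {n : ℕ}
    (hP : ∀ i : ℕ, n < i → IsZero (P.complex.X i)) : HasProjectiveDimensionLE X n := by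
  let := HasExt.standard C
  rw [HasProjectiveDimensionLE, hasProjectiveDimensionLT_iff]
  intro i hi Y x
  obtain ⟨f, hf, rfl⟩ := P.extMk_surjective x (i + 1) rfl
  obtain rfl : f = 0 := (hP i hi).eq_of_src _ _
  simp

variable [HasDerivedCategory.{w} C]

open DerivedCategory

lemma IsGhost.precomp {X Y Z : DerivedCategory C} (f : X ⟶ Y) {g : Y ⟶ Z} (hg : IsGhost g) :
    IsGhost (f ≫ g) := fun n ↦ by simp [hg n]

lemma IsGhost.postcomp {X Y Z : DerivedCategory C} {f : X ⟶ Y} (hf : IsGhost f) (g : Y ⟶ Z) :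
    IsGhost (f ≫ g) := fun n ↦ by simp [hf n]

lemma isGhost_Q_map_iff {K L : CochainComplex C ℤ} (f : K ⟶ L) :
    IsGhost (Q.map f) ↔ ∀ i, HomologicalComplex.homologyMap f i = 0 := by
  refine forall_congr' fun i ↦ ?_
  rw [← cancel_mono ((homologyFunctorFactors C i).hom.app L),
    homologyFunctorFactors_hom_naturality, zero_comp]
  exact Preadditive.IsIso.comp_left_eq_zero _ _

lemma CochainComplex.IsKProjective.Q_map_surjective (K L : CochainComplex C ℤ)
    [K.IsKProjective] : Function.Surjective (Q.map : (K ⟶ L) → _) := fun f ↦ by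
  obtain ⟨g, hg⟩ := (Qh_map_bijective K ((HomotopyCategory.quotient _ _).obj L)).surjective
    ((quotientCompQhIso C).hom.app K ≫ f ≫ (quotientCompQhIso C).inv.app L)
  obtain ⟨g, rfl⟩ := (HomotopyCategory.quotient _ _).map_surjective g
  refine ⟨g, ?_⟩
  rw [← cancel_epi ((quotientCompQhIso C).hom.app K), ← quotientCompQhIso_hom_naturality, hg]
  simp

lemma IsGhost.eq_zero_of_d_eq_zero {K : CochainComplex C ℤ} [∀ i, Projective (K.X i)]
    (hK : ∀ i j, K.d i j = 0) {Y : DerivedCategory C} {f : Q.obj K ⟶ Y} (hf : IsGhost f) :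
    f = 0 := by
  have := isKProjective_of_d_eq_zero hK
  let e := Q.objObjPreimageIso Y
  obtain ⟨g, hg⟩ := CochainComplex.IsKProjective.Q_map_surjective _ _ (f ≫ e.inv)
  have hg' := (isGhost_Q_map_iff g).1 (hg ▸ hf.postcomp _)
  obtain ⟨h⟩ := nonempty_homotopy_zero_of_homologyMap_eq_zero hK g hg'
  rw [← cancel_mono e.inv, ← hg, DerivedCategory.Q_map_eq_of_homotopy C h, Functor.map_zero, zero_comp]

/-- Morphisms from projective objects to the homology objects of `X` are realized by a
morphism in the derived category, from an object which supports no nonzero ghost. -/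
lemma exists_realization (X : DerivedCategory C) (M : ℤ → C) [∀ i, Projective (M i)]
    (q : ∀ i, M i ⟶ (homologyFunctor C i).obj X) :
    ∃ (P : DerivedCategory C) (p : P ⟶ X) (e : ∀ i, (homologyFunctor C i).obj P ≅ M i),
      (∀ i, (homologyFunctor C i).map p = (e i).hom ≫ q i) ∧
      ∀ ⦃Y : DerivedCategory C⦄ (f : P ⟶ Y), IsGhost f → f = 0 := by
  let K := zeroDifferentialComplex M
  have : ∀ i, Projective (K.X i) := inferInstanceAs (∀ i, Projective (M i))
  have hK : ∀ i j, K.d i j = 0 := fun _ _ ↦ rfl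
  let L := Q.objPreimage X
  let φ : Q.obj L ≅ X := Q.objObjPreimageIso X
  let e (i : ℤ) : K.homology i ≅ M i := zeroDifferentialComplexHomologyIso M i
  let α (N : CochainComplex C ℤ) (i : ℤ) : (homologyFunctor C i).obj (Q.obj N) ≅ N.homology i :=
    (homologyFunctorFactors C i).app N
  have hα (f : K ⟶ L) (i : ℤ) : (homologyFunctor C i).map (Q.map f) =
      (α K i).hom ≫ HomologicalComplex.homologyMap f i ≫ (α L i).inv := by
    rw [← Category.assoc, Iso.eq_comp_inv]
    exact homologyFunctorFactors_hom_naturality f i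
  obtain ⟨f, hf⟩ := exists_hom_homologyMap_eq (L := L) hK (fun i ↦ (e i).hom ≫ q i ≫
    (homologyFunctor C i).map φ.inv ≫ (α L i).hom)
  refine ⟨Q.obj K, Q.map f ≫ φ.hom, fun i ↦ α K i ≪≫ e i,
    fun i ↦ ?_, fun Y g hg ↦ hg.eq_zero_of_d_eq_zero hK⟩
  rw [Functor.map_comp, hα, hf]
  simp [← Functor.map_comp]

/-- If every ghost out of `X` factors through `w : X ⟶ X'`, then any composite of `k + 2` ghosts
out of `X` factors through `w` as a composite of `k + 1` ghosts. -/
lemma IsGhostComposite.exists_factorization {X Y X' : DerivedCategory C} {f : X ⟶ Y} {k : ℕ}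
    (hf : IsGhostComposite f k) (w : X ⟶ X')
    (hw : ∀ ⦃Z : DerivedCategory C⦄ (g : X ⟶ Z), IsGhost g → ∃ g' : X' ⟶ Z, g = w ≫ g') :
    ∃ f' : X' ⟶ Y, f = w ≫ f' ∧ ∀ m, k = m + 2 → IsGhostComposite f' (m + 1) := by
  induction hf with
  | single h =>
    obtain ⟨g', rfl⟩ := hw _ h
    exact ⟨g', rfl, fun m hm ↦ by omega⟩
  | @comp _ _ _ g k _ hg ih =>
    obtain ⟨f', rfl, h⟩ := ih
    refine ⟨f' ≫ g, by simp, fun m hm ↦ ?_⟩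
    obtain rfl : k = m + 1 := by omega
    cases m with
    | zero => exact .single (hg.precomp f')
    | succ m => exact .comp (h m rfl) hg

theorem ghost_composite_eq_zero_of_hasProjectiveDimensionLE [EnoughProjectives C] (n : ℕ)
    {X Y : DerivedCategory C}
    (hX : ∀ i : ℤ, HasProjectiveDimensionLE ((homologyFunctor C i).obj X) n)
    (f : X ⟶ Y) (hf : IsGhostComposite f (n + 1)) : f = 0 := by
  induction n generalizing X with
  | zero =>
    have (i : ℤ) : Projective ((homologyFunctor C i).obj X) :=
      (projective_iff_hasProjectiveDimensionLE_zero _).2 (hX i)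
    obtain ⟨P, p, e, hp, hP⟩ := exists_realization X _ (fun i ↦ 𝟙 _)
    have : IsIso p := by
      rw [isIso_iff]
      intro i
      rw [hp]
      infer_instance
    have hf : IsGhost f := by
      cases hf with
      | single h => exact h
      | comp h _ => nomatch h
    rw [← cancel_epi p, hP _ (hf.precomp p), comp_zero]
  | succ n ih =>
    obtain ⟨P, p, e, hp, hP⟩ := exists_realization X _
      (fun i ↦ Projective.π ((homologyFunctor C i).obj X))
    obtain ⟨X', w, δ, hT⟩ := distinguished_cocone_triangle p
    have hp_epi (i : ℤ) : Epi ((homologyFunctor C i).map p) := by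
      rw [hp]
      infer_instance
    obtain ⟨f', rfl, hf'⟩ := hf.exists_factorization w
      (fun Z g hg ↦ Triangle.yoneda_exact₂ _ hT g (hP _ (hg.precomp p)))
    rw [ih (fun i ↦ ?_) f' (hf' n rfl), comp_zero]
    have hw : (homologyFunctor C i).map w = 0 :=
      (HomologySequence.epi_homologyMap_mor₁_iff _ hT i).1 (hp_epi i)
    have hS : (ShortComplex.mk _ _ (HomologySequence.δ_comp _ hT i (i + 1))).ShortExact :=
      { exact := HomologySequence.exact₁ _ hT i (i + 1)
        mono_f := (HomologySequence.exact₃ _ hT i (i + 1)).mono_g hw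
        epi_g := hp_epi (i + 1) }
    have := Projective.of_iso (e (i + 1)).symm inferInstance
    exact (hS.hasProjectiveDimensionLT_X₃_iff n this).1 (hX (i + 1))

end

/-- If `X` is an object of the derived category of right `R`-modules all of whose
homology modules have projective dimension at most `n`, then any composite of `n + 1` ghosts
starting at `X` is zero. -/
theorem ghost_composite_eq_zero_of_homology_projDim_le
    (R : Type) [Ring R] [HasDerivedCategory.{w} (ModuleCat Rᵐᵒᵖ)] (n : ℕ)
    (X : DerivedCategory (ModuleCat Rᵐᵒᵖ))
    (hX : ∀ i : ℤ, HasProjDimLE ((DerivedCategory.homologyFunctor (ModuleCat Rᵐᵒᵖ) i).obj X) n)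
    (Y : DerivedCategory (ModuleCat Rᵐᵒᵖ)) (f : X ⟶ Y)
    (hf : IsGhostComposite f (n + 1)) : f = 0 := by
  exact ghost_composite_eq_zero_of_hasProjectiveDimensionLE n
    (fun i ↦ let ⟨P, hP⟩ := hX i; P.hasProjectiveDimensionLE hP) f hf
end

section
/- Let $A$ and $B$ be rings and suppose there is an equivalence of categories between the derived category $D(A)$ of right $A$-modules and the derived category $D(B)$ of right $B$-modules which commutes with the shift functors and is triangulated (sends distinguished triangles to distinguished triangles). If there exists a natural number $n$ such that every right $A$-module has projective dimension at most $n$, then there exists a natural number $m$ such that every right $B$-module has projective dimension at most $m$. That is, finiteness of right global dimension is invariant under derived equivalence. -/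
open CategoryTheory

universe wa wb

section
universe v u
variable {C : Type u} [Category.{v} C] [Abelian C]

lemma exists_projectiveResolution_of_exact {Z : C} (K : ChainComplex C ℕ)
    [∀ n, Projective (K.X n)] (f : K.X 0 ⟶ Z) (w : K.d 1 0 ≫ f = 0) [Epi f]
    (hf : (ShortComplex.mk _ _ w).Exact) (hK : ∀ n, K.ExactAt (n + 1)) :
    ∃ P : ProjectiveResolution Z, P.complex = K := by
  refine ⟨{ complex := K
            π := (ChainComplex.toSingle₀Equiv _ _).symm ⟨f, w⟩
            quasiIso := ⟨fun n => ?_⟩ }, rfl⟩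
  cases n with
  | zero =>
    rw [ChainComplex.quasiIsoAt₀_iff, ShortComplex.quasiIso_iff_of_zeros']
    · refine (ShortComplex.exact_and_epi_g_iff_of_iso ?_).2 ⟨hf, by dsimp; infer_instance⟩
      exact ShortComplex.isoMk (Iso.refl _) (Iso.refl _) (Iso.refl _)
        ((Category.id_comp _).trans (Category.comp_id _).symm)
        ((Category.id_comp _).trans ((ChainComplex.toSingle₀Equiv_symm_apply_f_zero f w).symm.trans
          (Category.comp_id _).symm))
    · exact K.shape _ _ (by simp)
    · rfl
    · rfl
  | succ n =>
    rw [quasiIsoAt_iff_exactAt']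
    · exact hK n
    · apply ChainComplex.exactAt_succ_single_obj

lemma exists_projectiveResolution_of_shortExact {S : ShortComplex C} (hS : S.ShortExact)
    [Projective S.X₂] (R : ProjectiveResolution S.X₁) :
    ∃ P : ProjectiveResolution S.X₃, ∀ i, P.complex.X (i + 1) = R.complex.X i := by
  have := hS.mono_f
  have := hS.epi_g
  obtain ⟨π₀, hπ₀, hR₀, hR₁⟩ : ∃ (π₀ : R.complex.X 0 ⟶ S.X₁) (_ : Epi π₀)
      (w : R.complex.d 1 0 ≫ π₀ = 0), (ShortComplex.mk _ _ w).Exact :=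
    ⟨R.π.f 0, (inferInstance : Epi (R.π.f 0)), R.complex_d_comp_π_f_zero, R.exact₀⟩
  let K : ChainComplex C ℕ := ChainComplex.augment R.complex (π₀ ≫ S.f)
    (by rw [reassoc_of% hR₀, Limits.zero_comp])
  have : ∀ n, Projective (K.X n) := by
    rintro (_ | n)
    · exact (inferInstance : Projective S.X₂)
    · exact R.projective n
  have w : K.d 1 0 ≫ S.g = 0 := by
    change (π₀ ≫ S.f) ≫ S.g = 0
    rw [Category.assoc, S.zero, Limits.comp_zero]
  have : @Epi C _ (K.X 0) S.X₃ S.g := hS.epi_g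
  obtain ⟨P, hP⟩ := exists_projectiveResolution_of_exact (Z := S.X₃) K S.g w
    (by
      have h := hS.exact
      let φ : ShortComplex.mk _ _ w ⟶ S :=
        { τ₁ := π₀, τ₂ := 𝟙 _, τ₃ := 𝟙 _, comm₁₂ := (Category.comp_id _).symm
          comm₂₃ := (Category.id_comp _).trans (Category.comp_id _).symm }
      have : Epi φ.τ₁ := (inferInstance : Epi π₀)
      have : IsIso φ.τ₂ := (inferInstance : IsIso (𝟙 S.X₂))
      have : Mono φ.τ₃ := (inferInstance : Mono (𝟙 S.X₃))
      exact (ShortComplex.exact_iff_of_epi_of_isIso_of_mono φ).2 h)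
    (by
      rintro (_ | n)
      · rw [HomologicalComplex.exactAt_iff' _ 2 1 0 (by simp) (by simp)]
        let φ : ShortComplex.mk _ _ hR₀ ⟶ K.sc' 2 1 0 :=
          { τ₁ := 𝟙 _, τ₂ := 𝟙 _, τ₃ := S.f
            comm₁₂ := (Category.id_comp _).trans (Category.comp_id _).symm
            comm₂₃ := Category.id_comp _ }
        have : Epi φ.τ₁ := (inferInstance : Epi (𝟙 (R.complex.X 1)))
        have : IsIso φ.τ₂ := (inferInstance : IsIso (𝟙 (R.complex.X 0)))
        have : Mono φ.τ₃ := (inferInstance : Mono S.f)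
        exact (ShortComplex.exact_iff_of_epi_of_isIso_of_mono φ).1 hR₁
      · rw [HomologicalComplex.exactAt_iff' _ (n + 3) (n + 2) (n + 1) (by simp) (by simp)]
        exact R.exact_succ n)
  exact ⟨P, fun i => by rw [hP]; rfl⟩

lemma hasProjDimLE_of_hasProjectiveDimensionLE [EnoughProjectives C] (n : ℕ) :
    ∀ X : C, HasProjectiveDimensionLE X n → HasProjDimLE X n := by
  induction n with
  | zero =>
    intro X hX
    have : Projective X := (projective_iff_hasProjectiveDimensionLE_zero X).2 hX
    refine ⟨ProjectiveResolution.self X, fun i hi => ?_⟩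
    exact HomologicalComplex.isZero_single_obj_X _ _ _ _ (by simpa using hi.ne')
  | succ n ih =>
    intro X hX
    obtain ⟨p⟩ := EnoughProjectives.presentation X
    have := p.projective
    have := p.epi
    have hS : (ShortComplex.mk (Limits.kernel.ι p.f) p.f (Limits.kernel.condition _)).ShortExact :=
      { exact := ShortComplex.exact_kernel p.f }
    obtain ⟨R, hR⟩ := ih _ ((hS.hasProjectiveDimensionLT_X₃_iff n p.projective).1 hX)
    obtain ⟨P, hP⟩ := exists_projectiveResolution_of_shortExact hS R
    refine ⟨P, fun i hi => ?_⟩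
    obtain ⟨i, rfl⟩ : ∃ j, i = j + 1 := ⟨i - 1, by omega⟩
    rw [hP]
    exact hR i (by omega)
end

section
universe v v'
variable {R : Type} [Ring R]
open Abelian

lemma injective_of_ext_one_quotient_eq_zero (N : ModuleCat.{v} R)
    (hN : ∀ (I : Ideal R) (x : Ext.{v} (ModuleCat.of R (ULift.{v} (R ⧸ I))) N 1), x = 0) :
    Injective N := by
  rw [← Module.injective_iff_injective_object]
  refine Module.Baer.injective fun I g => ?_
  let S : ShortComplex (ModuleCat.{v} R) :=
    { X₁ := ModuleCat.of R (ULift.{v} I)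
      X₂ := ModuleCat.of R (ULift.{v} R)
      X₃ := ModuleCat.of R (ULift.{v} (R ⧸ I))
      f := ModuleCat.ofHom (ULift.moduleEquiv.symm.toLinearMap ∘ₗ I.subtype ∘ₗ
        ULift.moduleEquiv.toLinearMap)
      g := ModuleCat.ofHom (ULift.moduleEquiv.symm.toLinearMap ∘ₗ I.mkQ ∘ₗ
        ULift.moduleEquiv.toLinearMap)
      zero := by
        ext x
        simp }
  have hS : S.ShortExact :=
    { exact := by
        rw [ShortComplex.moduleCat_exact_iff]
        rintro ⟨x⟩ hx
        have hx' : x ∈ I := by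
          have : I.mkQ x = 0 := ULift.up_injective hx
          simpa using this
        exact ⟨⟨⟨x, hx'⟩⟩, rfl⟩
      mono_f := by
        rw [ModuleCat.mono_iff_injective]
        rintro ⟨x⟩ ⟨y⟩ h
        have : x.1 = y.1 := ULift.up_injective h
        exact congrArg ULift.up (Subtype.ext this)
      epi_g := by
        rw [ModuleCat.epi_iff_surjective]
        rintro ⟨x⟩
        obtain ⟨x, rfl⟩ := I.mkQ_surjective x
        exact ⟨⟨x⟩, rfl⟩ }
  let g' : S.X₁ ⟶ N := ModuleCat.ofHom (g ∘ₗ ULift.moduleEquiv.toLinearMap)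
  obtain ⟨φ, hφ⟩ := Ext.contravariant_sequence_exact₁ hS _ (Ext.mk₀ g') (zero_add 1) (hN I _)
  obtain ⟨φ, rfl⟩ := Ext.homEquiv₀.symm.surjective φ
  have h : S.f ≫ φ = g' := Ext.homEquiv₀.symm.injective (by simpa using hφ)
  refine ⟨φ.hom ∘ₗ ULift.moduleEquiv.symm.toLinearMap, fun x hx => ?_⟩
  exact congrArg (fun u : S.X₁ ⟶ N => u.hom ⟨⟨x, hx⟩⟩) h

lemma hasInjectiveDimensionLE_of_quotients (n : ℕ)
    (h : ∀ I : Ideal R, HasProjectiveDimensionLE (ModuleCat.of R (ULift.{v} (R ⧸ I))) n) :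
    ∀ N : ModuleCat.{v} R, HasInjectiveDimensionLE N n := by
  suffices H : ∀ (k : ℕ) (N : ModuleCat.{v} R),
      (∀ (I : Ideal R) (x : Ext.{v} (ModuleCat.of R (ULift.{v} (R ⧸ I))) N (k + 1)), x = 0) →
        HasInjectiveDimensionLE N k from
    fun N => H n N fun I x => x.eq_zero_of_hasProjectiveDimensionLT (n + 1) le_rfl
  intro k
  induction k with
  | zero =>
    intro N hN
    exact injective_iff_hasInjectiveDimensionLT_one.1 (injective_of_ext_one_quotient_eq_zero N hN)
  | succ k ih =>
    intro N hN
    obtain ⟨p⟩ := EnoughInjectives.presentation N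
    have := p.injective
    have := p.mono
    have hS : (ShortComplex.mk p.f (Limits.cokernel.π p.f)
        (Limits.cokernel.condition _)).ShortExact :=
      { exact := ShortComplex.exact_cokernel p.f }
    refine (hS.hasInjectiveDimensionLT_X₃_iff k p.injective).1 (ih _ fun I x => ?_)
    obtain ⟨y, rfl⟩ := Ext.covariant_sequence_exact₃ _ hS x rfl (hN I _)
    rw [y.eq_zero_of_injective, Ext.zero_comp]

lemma hasProjectiveDimensionLE_of_quotients (n : ℕ)
    (h : ∀ I : Ideal R, HasProjectiveDimensionLE (ModuleCat.of R (ULift.{v} (R ⧸ I))) n)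
    (M : ModuleCat.{v} R) : HasProjectiveDimensionLE M n :=
  HasProjectiveDimensionLT.mk fun _ hi N x =>
    have := hasInjectiveDimensionLE_of_quotients n h N
    x.eq_zero_of_hasInjectiveDimensionLT (n + 1) hi

lemma hasProjectiveDimensionLE_universe_change (n : ℕ)
    (h : ∀ M : ModuleCat.{v} R, HasProjectiveDimensionLE M n) (M : ModuleCat.{v'} R) :
    HasProjectiveDimensionLE M n :=
  hasProjectiveDimensionLE_of_quotients n (fun I =>
    have := h (ModuleCat.of R (ULift.{v} (R ⧸ I)))
    ModuleCat.hasProjectiveDimensionLE_of_linearEquiv.{v, v'}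
      (M := ModuleCat.of R (ULift.{v} (R ⧸ I))) (ULift.moduleEquiv.trans ULift.moduleEquiv.symm) n)
    M
end

section
universe w v u
variable {C : Type u} [Category.{v} C] [Abelian C] [HasDerivedCategory.{w} C]
open DerivedCategory Limits Pretriangulated

lemma exists_Q_map_eq (K L : CochainComplex C ℤ) [K.IsKProjective] (f : Q.obj K ⟶ Q.obj L) :
    ∃ g : K ⟶ L, Q.map g = f := by
  obtain ⟨φ, hφ⟩ := (CochainComplex.IsKProjective.Qh_map_bijective K
    ((HomotopyCategory.quotient _ _).obj L)).surjective
      ((quotientCompQhIso C).hom.app K ≫ f ≫ (quotientCompQhIso C).inv.app L)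
  obtain ⟨g, rfl⟩ := (HomotopyCategory.quotient _ _).map_surjective φ
  refine ⟨g, ?_⟩
  rw [← cancel_epi ((quotientCompQhIso C).hom.app K),
    ← (quotientCompQhIso C).hom.naturality, Functor.comp_map, hφ]
  simp

lemma nonempty_homotopy_of_Q_map_eq {K L : CochainComplex C ℤ} [K.IsKProjective] (g g' : K ⟶ L)
    (h : Q.map g = Q.map g') : Nonempty (Homotopy g g') := by
  refine ⟨HomotopyCategory.homotopyOfEq _ _
    ((CochainComplex.IsKProjective.Qh_map_bijective K _).injective ?_)⟩
  rw [← cancel_mono ((quotientCompQhIso C).hom.app L)]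
  have h₁ := (quotientCompQhIso C).hom.naturality g
  have h₂ := (quotientCompQhIso C).hom.naturality g'
  dsimp only [Functor.comp_map] at h₁ h₂
  rw [h₁, h₂, h]

lemma eq_zero_of_isStrictlyGE_of_isLE (K : CochainComplex C ℤ) [K.IsKProjective] (a b : ℤ)
    (hab : b < a) [K.IsStrictlyGE a] (Y : DerivedCategory C) [Y.IsLE b] (f : Q.obj K ⟶ Y) :
    f = 0 := by
  obtain ⟨L, _, ⟨e⟩⟩ := Y.exists_iso_Q_obj_of_isLE b
  obtain ⟨g, hg⟩ := exists_Q_map_eq K L (f ≫ e.hom)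
  have : g = 0 := by
    ext i
    by_cases hi : i < a
    · exact (K.isZero_of_isStrictlyGE a i hi).eq_of_src _ _
    · exact (L.isZero_of_isStrictlyLE b i (by lia)).eq_of_tgt _ _
  rw [← cancel_mono e.hom, ← hg, this]
  simp

/-- The shift of a projective resolution, as an object of the derived category. -/
noncomputable def resolutionShiftIso {M : C} (R : ProjectiveResolution M) (j : ℤ) :
    Q.obj (R.cochainComplex⟦j⟧) ≅ ((singleFunctor C 0).obj M)⟦j⟧ :=
  (Q.commShiftIso j).app _ ≪≫ (shiftFunctor (DerivedCategory C) j).mapIso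
    (haveI := (isIso_Q_map_iff_quasiIso C R.π').2 inferInstance
     asIso (Q.map R.π') ≪≫ (singleFunctorIsoCompQ C 0).symm.app M)

/-- An object placed in degree `j` is a shift of the object placed in degree `0`. -/
noncomputable def singleFunctorShiftIso (M : C) (j : ℤ) :
    (singleFunctor C j).obj M ≅ ((singleFunctor C 0).obj M)⟦-j⟧ :=
  ((singleFunctors C).shiftIso (-j) j 0 (by simp)).symm.app M

lemma hom_shift_single_eq_zero {M : C} {n : ℕ} (hM : HasProjDimLE M n) (j b : ℤ)
    (hb : b + n + j < 0) (Y : DerivedCategory C) [Y.IsLE b]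
    (f : ((singleFunctor C 0).obj M)⟦j⟧ ⟶ Y) : f = 0 := by
  obtain ⟨R, hR⟩ := hM
  have : R.cochainComplex.IsKProjective :=
    CochainComplex.isKProjective_of_projective _ 0
  have : R.cochainComplex.IsStrictlyGE (-n) := by
    rw [CochainComplex.isStrictlyGE_iff]
    intro i hi
    obtain ⟨k, rfl⟩ : ∃ k : ℕ, i = -k := ⟨i.natAbs, by omega⟩
    exact (hR k (by omega)).of_iso (R.cochainComplexXIso (-k) k)
  have : (R.cochainComplex⟦j⟧).IsStrictlyGE (-n - j) :=
    R.cochainComplex.isStrictlyGE_shift (-n) j _ (by lia)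
  rw [← cancel_epi (resolutionShiftIso R j).hom, comp_zero]
  exact eq_zero_of_isStrictlyGE_of_isLE _ (-n - j) b (by lia) _ _

lemma hom_eq_zero_of_isGE_of_isLE {n : ℕ} (hC : ∀ M : C, HasProjDimLE M n) (a b' : ℤ)
    (h : b' + n < a) (Y : DerivedCategory C) [Y.IsLE b'] (d : ℕ) :
    ∀ (X : DerivedCategory C) [X.IsGE a] [X.IsLE (a + d)] (f : X ⟶ Y), f = 0 := by
  have hsingle (j : ℤ) (hj : a ≤ j) (X : DerivedCategory C) [X.IsGE j] [X.IsLE j] (f : X ⟶ Y) :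
      f = 0 := by
    obtain ⟨M, ⟨e⟩⟩ := X.exists_iso_singleFunctor_obj_of_isGE_of_isLE j
    rw [← cancel_epi e.inv, ← cancel_epi (singleFunctorShiftIso M j).inv, comp_zero, comp_zero]
    exact hom_shift_single_eq_zero (hC M) _ b' (by lia) _ _
  induction d with
  | zero =>
    intro X hX hX' f
    have : X.IsLE a := by simpa using hX'
    exact hsingle a le_rfl X f
  | succ d ih =>
    intro X hX hX' f
    obtain ⟨X₁, X₃, h₁, h₃, i, p, δ, hT⟩ := TStructure.t.exists_triangle X (a + d) (a + (d + 1 : ℕ))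
      (by push_cast; ring)
    have h₁' : X₁.IsLE (a + d) := ⟨h₁⟩
    have h₃' : X₃.IsGE (a + (d + 1 : ℕ)) := ⟨h₃⟩
    have h₁'' : X₁.IsGE a := TStructure.t.isGE₂ _ (inv_rot_of_distTriang _ hT) a
      (by
        have := TStructure.t.isGE_shift X₃ (a + (d + 1 : ℕ)) (-1) (a + (d + 2 : ℕ))
          (by push_cast; ring)
        exact TStructure.t.isGE_of_ge (X₃⟦(-1 : ℤ)⟧) a (a + (d + 2 : ℕ)) (by lia)) hX
    have h₃'' : X₃.IsLE (a + (d + 1 : ℕ)) := TStructure.t.isLE₂ _ (rot_of_distTriang _ hT) _ hX'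
      (by
        have := TStructure.t.isLE_shift X₁ (a + d) 1 (a + d - 1) (by ring)
        exact TStructure.t.isLE_of_le (X₁⟦(1 : ℤ)⟧) (a + d - 1) _ (by lia))
    obtain ⟨g, hg⟩ := Triangle.yoneda_exact₂ _ hT f (ih X₁ _)
    have hg' : g = 0 := hsingle (a + (d + 1 : ℕ)) (by lia) X₃ g
    rw [hg, hg']
    exact comp_zero

lemma hasProjectiveDimensionLE_of_forall_hom_eq_zero {M : C} {n : ℕ}
    (h : ∀ (i : ℕ) (_ : n < i) (N : C)
      (f : (singleFunctor C 0).obj M ⟶ ((singleFunctor C 0).obj N)⟦(i : ℤ)⟧), f = 0) :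
    HasProjectiveDimensionLE M n := by
  let := HasExt.standard C
  refine HasProjectiveDimensionLT.mk fun i hi N x => ?_
  apply (Abelian.Ext.homEquiv (C := C)).injective
  exact (h i hi N _).trans (h i hi N _).symm

lemma isLE_singleFunctor_shift (M : C) (j : ℤ) :
    (((singleFunctor C 0).obj M)⟦j⟧).IsLE (-j) :=
  TStructure.t.isLE_shift _ 0 j (-j)

end

lemma hasProjectiveDimensionLE_of_hasProjDimLE {C : Type*} [Category C] [Abelian C] {M : C} {n : ℕ}
    (hM : HasProjDimLE M n) : HasProjectiveDimensionLE M n := by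
  let := HasDerivedCategory.standard C
  refine hasProjectiveDimensionLE_of_forall_hom_eq_zero fun i hi N f => ?_
  have := isLE_singleFunctor_shift N i
  rw [← cancel_epi ((shiftFunctorZero _ ℤ).hom.app _), Limits.comp_zero]
  exact hom_shift_single_eq_zero hM 0 (-i) (by lia) _ _

section
universe w v u
variable {C : Type u} [Category.{v} C] [Abelian C]
open Limits

/-- In each degree, the coproduct of cochain complexes is the coproduct of the terms. -/
noncomputable def isColimitCofanX [HasCoproductsOfShape ℕ C] (Y : ℕ → CochainComplex C ℤ) (i : ℤ) :
    IsColimit (Cofan.mk ((∐ Y).X i) fun k => (Sigma.ι Y k).f i : Cofan fun k => (Y k).X i) :=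
  isColimitOfHasCoproductOfPreservesColimit (HomologicalComplex.eval C (ComplexShape.up ℤ) i) Y

/-- In each degree, the product of cochain complexes is the product of the terms. -/
noncomputable def isLimitFanX [HasProductsOfShape ℕ C] (Y : ℕ → CochainComplex C ℤ) (i : ℤ) :
    IsLimit (Fan.mk ((∏ᶜ Y).X i) fun k => (Pi.π Y k).f i : Fan fun k => (Y k).X i) :=
  isLimitOfHasProductOfPreservesLimit (HomologicalComplex.eval C (ComplexShape.up ℤ) i) Y

section
variable [HasCoproductsOfShape ℕ C] (Y : ℕ → CochainComplex C ℤ)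

lemma coproduct_X_hom_ext {i : ℤ} {W : C} {f g : (∐ Y).X i ⟶ W}
    (h : ∀ k, (Sigma.ι Y k).f i ≫ f = (Sigma.ι Y k).f i ≫ g) : f = g :=
  Cofan.IsColimit.hom_ext (isColimitCofanX Y i) _ _ h

lemma nonempty_homotopy_zero_of_coproduct {L : CochainComplex C ℤ} (f : ∐ Y ⟶ L)
    (h : ∀ k, Nonempty (Homotopy (Sigma.ι Y k ≫ f) 0)) : Nonempty (Homotopy f 0) := by
  let H (k : ℕ) := (h k).some
  let φ (i j : ℤ) : (∐ Y).X i ⟶ L.X j :=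
    Cofan.IsColimit.desc (isColimitCofanX Y i) fun k => (H k).hom i j
  have hφ (i j : ℤ) (k : ℕ) : (Sigma.ι Y k).f i ≫ φ i j = (H k).hom i j :=
    Cofan.IsColimit.fac (isColimitCofanX Y i) _ k
  refine ⟨{ hom := φ, zero := fun i j hij => ?_, comm := fun i => ?_ }⟩
  · refine coproduct_X_hom_ext Y fun k => ?_
    rw [hφ, (H k).zero i j hij, comp_zero]
  · refine coproduct_X_hom_ext Y fun k => ?_
    have h₁ : (ComplexShape.up ℤ).Rel i (i + 1) := rfl
    have h₂ : (ComplexShape.up ℤ).Rel (i - 1) i := by simp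
    have := (H k).comm i
    rw [dNext_eq _ h₁, prevD_eq _ h₂] at this ⊢
    simp only [HomologicalComplex.comp_f] at this
    rw [this]
    simp [← hφ]

instance isKProjective_coproduct [∀ k, (Y k).IsKProjective] : (∐ Y).IsKProjective where
  nonempty_homotopy_zero f hL := nonempty_homotopy_zero_of_coproduct Y f fun k =>
    CochainComplex.IsKProjective.nonempty_homotopy_zero (Sigma.ι Y k ≫ f) hL

open DerivedCategory in
lemma exists_isColimit_cofan_Q [HasDerivedCategory.{w} C] [∀ k, (Y k).IsKProjective] :
    Nonempty (IsColimit (Cofan.mk (Q.obj (∐ Y)) fun k => Q.map (Sigma.ι Y k) :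
      Cofan fun k => Q.obj (Y k))) := by
  have uniq {L : CochainComplex C ℤ} (φ ψ : Q.obj (∐ Y) ⟶ Q.obj L)
      (h : ∀ k, Q.map (Sigma.ι Y k) ≫ φ = Q.map (Sigma.ι Y k) ≫ ψ) : φ = ψ := by
    obtain ⟨f, rfl⟩ := exists_Q_map_eq _ _ φ
    obtain ⟨g, rfl⟩ := exists_Q_map_eq _ _ ψ
    have : Nonempty (Homotopy (f - g) 0) :=
      nonempty_homotopy_zero_of_coproduct Y _ fun k =>
        nonempty_homotopy_of_Q_map_eq _ _ (by
          rw [Functor.map_comp, Functor.map_sub, Preadditive.comp_sub, h, sub_self,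
            Functor.map_zero])
    have := Q_map_eq_of_homotopy C this.some
    rwa [Functor.map_sub, Functor.map_zero, sub_eq_zero] at this
  have exist (W : DerivedCategory C) (a : ∀ k, Q.obj (Y k) ⟶ W) :
      ∃ φ : Q.obj (∐ Y) ⟶ W, ∀ k, Q.map (Sigma.ι Y k) ≫ φ = a k := by
    let e := Q.objObjPreimageIso W
    choose g hg using fun k => exists_Q_map_eq (Y k) _ (a k ≫ e.inv)
    refine ⟨Q.map (Sigma.desc g) ≫ e.hom, fun k => ?_⟩
    rw [← Category.assoc, ← Functor.map_comp, Sigma.ι_desc, hg, Category.assoc, e.inv_hom_id,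
      Category.comp_id]
  choose desc hdesc using exist
  refine ⟨Cofan.IsColimit.mk _ (fun s => desc s.pt s.inj) (fun s k => hdesc _ _ k)
    fun s m hm => ?_⟩
  let e := Q.objObjPreimageIso s.pt
  rw [← cancel_mono e.inv]
  refine uniq _ _ fun k => ?_
  rw [← Category.assoc, ← Category.assoc, hdesc]
  exact congrArg (· ≫ e.inv) (hm k)

end
end

section
universe w v u
open Limits
variable {C : Type u} [Category.{v} C] [Abelian C] [HasProductsOfShape ℕ C]

lemma quasiIso_pi_map [EnoughProjectives C] {Y Y' : ℕ → CochainComplex C ℤ}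
    (s : ∀ k, Y k ⟶ Y' k) [∀ k, QuasiIso (s k)] : QuasiIso (Limits.Pi.map s) := by
  have hπ {W : ℕ → CochainComplex C ℤ} {i : ℤ} {A : C} {f g : A ⟶ (∏ᶜ W).X i}
      (h : ∀ k, f ≫ (Pi.π W k).f i = g ≫ (Pi.π W k).f i) : f = g :=
    Fan.IsLimit.hom_ext (isLimitFanX W i) _ _ h
  have hlift (W : ℕ → CochainComplex C ℤ) (i : ℤ) (A : C) (f : ∀ k, A ⟶ (W k).X i) :
      ∃ g : A ⟶ (∏ᶜ W).X i, ∀ k, g ≫ (Pi.π W k).f i = f k :=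
    ⟨Fan.IsLimit.lift (isLimitFanX W i) f, fun k => Fan.IsLimit.fac (isLimitFanX W i) f k⟩
  have hs (k : ℕ) (i : ℤ) : (Limits.Pi.map s).f i ≫ (Pi.π Y' k).f i = (Pi.π Y k).f i ≫ (s k).f i := by
    rw [← HomologicalComplex.comp_f, Limits.Pi.map_π, HomologicalComplex.comp_f]
  rw [quasiIso_iff]
  intro j
  have hi : (ComplexShape.up ℤ).prev j = j - 1 := by simp
  have hk : (ComplexShape.up ℤ).next j = j + 1 := by simp
  rw [quasiIsoAt_iff_isIso_homologyMap]
  have hmono : Mono (HomologicalComplex.homologyMap (Limits.Pi.map s) j) := by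
    rw [HomologicalComplex.mono_homologyMap_iff_up_to_refinements _ _ _ _ hi hk]
    intro A x hx y hxy
    have H (k : ℕ) := (HomologicalComplex.mono_homologyMap_iff_up_to_refinements (s k) _ _ _
      hi hk).1 inferInstance (Projective.π A ≫ x ≫ (Pi.π Y k).f j) (by
        simp [HomologicalComplex.Hom.comm, reassoc_of% hx])
        (Projective.π A ≫ y ≫ (Pi.π Y' k).f (j - 1)) (by
        simp only [Category.assoc, HomologicalComplex.Hom.comm, ← hs]
        rw [reassoc_of% hxy])
    choose A' p hp z hz using H
    obtain ⟨z', hz'⟩ := hlift Y (j - 1) (Projective.over A)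
      fun k => Projective.factorThru (𝟙 _) (p k) ≫ z k
    refine ⟨Projective.over A, Projective.π A, inferInstance, z', hπ fun k => ?_⟩
    simp only [Category.assoc, ← HomologicalComplex.Hom.comm]
    rw [reassoc_of% hz', ← hz, Projective.factorThru_comp_assoc, Category.id_comp]
  have hepi : Epi (HomologicalComplex.homologyMap (Limits.Pi.map s) j) := by
    rw [HomologicalComplex.epi_homologyMap_iff_up_to_refinements _ _ _ _ hi hk]
    intro A y hy
    have H (k : ℕ) := (HomologicalComplex.epi_homologyMap_iff_up_to_refinements (s k) _ _ _
      hi hk).1 inferInstance (Projective.π A ≫ y ≫ (Pi.π Y' k).f j) (by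
        simp [HomologicalComplex.Hom.comm, reassoc_of% hy])
    choose A' p hp x hx z hz using H
    obtain ⟨x', hx'⟩ := hlift Y j (Projective.over A)
      fun k => Projective.factorThru (𝟙 _) (p k) ≫ x k
    obtain ⟨z', hz'⟩ := hlift Y' (j - 1) (Projective.over A)
      fun k => Projective.factorThru (𝟙 _) (p k) ≫ z k
    refine ⟨Projective.over A, Projective.π A, inferInstance, x', hπ fun k => ?_, z',
      hπ fun k => ?_⟩
    · simp only [Category.assoc, ← HomologicalComplex.Hom.comm]
      rw [reassoc_of% hx', hx, comp_zero, zero_comp]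
    · simp only [Category.assoc, Preadditive.add_comp, ← HomologicalComplex.Hom.comm, hs]
      rw [reassoc_of% hx', reassoc_of% hz', ← Preadditive.comp_add, ← hz,
        Projective.factorThru_comp_assoc, Category.id_comp]
  exact isIso_of_mono_of_epi _

variable [HasCoproductsOfShape ℕ C]

lemma isIso_pi_lift_sigma_π (Y : ℕ → CochainComplex C ℤ)
    (hY : ∀ i : ℤ, ∃ N : ℕ, ∀ k, N ≤ k → IsZero ((Y k).X i)) :
    IsIso (Pi.lift (Sigma.π Y)) := by
  have hcan (i : ℤ) (k : ℕ) :
      (Pi.lift (Sigma.π Y)).f i ≫ (Pi.π Y k).f i = (Sigma.π Y k).f i := by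
    rw [← HomologicalComplex.comp_f, Pi.lift_π]
  have heq (i : ℤ) (k : ℕ) : (Sigma.ι Y k).f i ≫ (Sigma.π Y k).f i = 𝟙 _ := by
    rw [← HomologicalComplex.comp_f, Sigma.ι_π_eq_id, HomologicalComplex.id_f]
  have hne (i : ℤ) {k l : ℕ} (h : k ≠ l) : (Sigma.ι Y k).f i ≫ (Sigma.π Y l).f i = 0 := by
    rw [← HomologicalComplex.comp_f, Sigma.ι_π_of_ne _ h, HomologicalComplex.zero_f]
  suffices ∀ i, IsIso ((Pi.lift (Sigma.π Y)).f i) from HomologicalComplex.Hom.isIso_of_components _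
  intro i
  obtain ⟨N, hN⟩ := hY i
  refine ⟨∑ k ∈ Finset.range N, (Pi.π Y k).f i ≫ (Sigma.ι Y k).f i, ?_, ?_⟩
  · refine coproduct_X_hom_ext Y fun l => ?_
    by_cases hl : l < N
    · simp only [Preadditive.comp_sum, reassoc_of% hcan]
      rw [Finset.sum_eq_single_of_mem l (Finset.mem_range.2 hl), reassoc_of% heq,
        Category.comp_id]
      intro k _ hkl
      rw [reassoc_of% (hne i hkl.symm), zero_comp]
    · exact (hN l (not_lt.1 hl)).eq_of_src _ _
  · refine Fan.IsLimit.hom_ext (isLimitFanX Y i) _ _ fun l => ?_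
    change _ ≫ (Pi.π Y l).f i = _ ≫ (Pi.π Y l).f i
    by_cases hl : l < N
    · simp only [Preadditive.sum_comp, Category.assoc, hcan]
      rw [Finset.sum_eq_single_of_mem l (Finset.mem_range.2 hl), heq, Category.comp_id]
      · exact (Category.id_comp _).symm
      intro k _ hkl
      rw [hne i hkl, comp_zero]
    · exact (hN l (not_lt.1 hl)).eq_of_tgt _ _

open DerivedCategory in
lemma exists_hom_comp_sigma_π_eq [EnoughProjectives C] [HasDerivedCategory.{w} C]
    (Y : ℕ → CochainComplex C ℤ)
    (hY : ∀ i : ℤ, ∃ N : ℕ, ∀ k, N ≤ k → IsZero ((Y k).X i)) (X : DerivedCategory C)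
    (f : ∀ k, X ⟶ Q.obj (Y k)) :
    ∃ q : X ⟶ Q.obj (∐ Y), ∀ k, q ≫ Q.map (Sigma.π Y k) = f k := by
  have := isIso_pi_lift_sigma_π Y hY
  let e := Q.objObjPreimageIso X
  choose Y' g s hs hg using fun k => left_fac (e.hom ≫ f k)
  have (k : ℕ) : QuasiIso (s k) := (isIso_Q_map_iff_quasiIso C (s k)).1 (hs k)
  have : IsIso (Q.map (Limits.Pi.map s)) := (isIso_Q_map_iff_quasiIso C _).2 (quasiIso_pi_map s)
  refine ⟨e.inv ≫ Q.map (Pi.lift g) ≫ inv (Q.map (Limits.Pi.map s)) ≫ Q.map (inv (Pi.lift (Sigma.π Y))),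
    fun k => ?_⟩
  have h₁ : inv (Pi.lift (Sigma.π Y)) ≫ Sigma.π Y k = Pi.π Y k := by
    rw [IsIso.inv_comp_eq, Pi.lift_π]
  have h₂ : inv (Q.map (Limits.Pi.map s)) ≫ Q.map (Pi.π Y k) = Q.map (Pi.π Y' k) ≫ inv (Q.map (s k)) := by
    rw [IsIso.inv_comp_eq, ← Category.assoc, ← Functor.map_comp, Limits.Pi.map_π, Functor.map_comp,
      Category.assoc, IsIso.hom_inv_id, Category.comp_id]
  simp only [Category.assoc]
  rw [← Functor.map_comp, h₁, h₂, ← Functor.map_comp_assoc, Pi.lift_π, ← hg, e.inv_hom_id_assoc]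

end

section
universe w w' v v' u'
open Limits DerivedCategory

lemma finite_setOf_hom_apply_ne_zero {R : Type*} [Ring R] {X : ℕ → ModuleCat.{v} R}
    {P : ModuleCat.{v} R} {ι : ∀ k, X k ⟶ P} (hι : IsColimit (Cofan.mk P ι)) (p : ∀ k, P ⟶ X k)
    (h : ∀ {k l}, k ≠ l → ι k ≫ p l = 0) (z : P) : {l | (p l).hom z ≠ 0}.Finite := by
  let S : Submodule R P :=
    { carrier := {z | {l | (p l).hom z ≠ 0}.Finite}
      zero_mem' := by simp
      add_mem' := fun {a b} ha hb => (ha.union hb).subset fun l hl => by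
        by_contra h
        simp only [Set.mem_union, Set.mem_ofPred_eq, not_or, not_not] at h
        exact hl (by rw [map_add, h.1, h.2, add_zero])
      smul_mem' := fun c a ha => ha.subset fun l hl h => hl (by rw [map_smul, h, smul_zero]) }
  have hS : ModuleCat.ofHom S.mkQ = 0 := by
    refine Cofan.IsColimit.hom_ext hι _ _ fun k => ?_
    ext x
    refine (Submodule.Quotient.mk_eq_zero S).2 ?_
    refine (Set.finite_singleton k).subset fun l hl => ?_
    by_contra hkl
    exact hl (LinearMap.congr_fun (congrArg ModuleCat.Hom.hom (h (Ne.symm hkl))) x)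
  exact (Submodule.Quotient.mk_eq_zero S).1
    (LinearMap.congr_fun (congrArg ModuleCat.Hom.hom hS) z)

/-- The free module of rank one, in an arbitrary universe. -/
abbrev freeModule (R : Type) [Ring R] : ModuleCat.{v} R := ModuleCat.of R (ULift.{v} R)

instance projective_freeModule (R : Type) [Ring R] : Projective (freeModule.{v} R) :=
  have : Module.Projective R (ULift.{v} R) := Module.Projective.of_equiv ULift.moduleEquiv.symm
  (IsProjective.iff_projective (R := R) (ULift.{v} R)).1 this

lemma freeModule_hom_ext {R : Type} [Ring R] {M : ModuleCat.{v} R} {f g : freeModule R ⟶ M}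
    (h : f.hom ⟨1⟩ = g.hom ⟨1⟩) : f = g := by
  ext ⟨r⟩
  have : (⟨r⟩ : ULift R) = r • ⟨1⟩ := by ext; simp
  rw [this]
  exact ((map_smul f.hom r _).trans (congrArg (r • ·) h)).trans (map_smul g.hom r _).symm

variable {R : Type} [Ring R] [HasDerivedCategory.{w} (ModuleCat.{v} R)]

instance isKProjective_single_freeModule (R : Type) [Ring R] (i : ℤ) :
    ((CochainComplex.singleFunctor (ModuleCat.{v} R) i).obj (freeModule R)).IsKProjective := by
  have (j : ℤ) :
      Projective (((CochainComplex.singleFunctor (ModuleCat.{v} R) i).obj (freeModule R)).X j) := by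
    by_cases h : j = i
    · subst h
      exact Projective.of_iso (HomologicalComplex.singleObjXSelf (ComplexShape.up ℤ) j
        (freeModule R)).symm inferInstance
    · exact (HomologicalComplex.isZero_single_obj_X (ComplexShape.up ℤ) i
        (freeModule R) j h).projective
  exact CochainComplex.isKProjective_of_projective _ i

lemma finite_setOf_comp_Q_map_sigma_π_ne_zero (Z : ℕ → CochainComplex (ModuleCat.{v} R) ℤ)
    (x : (singleFunctor _ 0).obj (freeModule R) ⟶ Q.obj (∐ Z)) :
    {l | x ≫ Q.map (Sigma.π Z l) ≠ 0}.Finite := by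
  obtain ⟨g, hg⟩ := exists_Q_map_eq
    ((CochainComplex.singleFunctor _ 0).obj (freeModule R)) (∐ Z) x
  subst hg
  let i := (HomologicalComplex.singleObjXSelf (ComplexShape.up ℤ) 0 (freeModule.{v} R)).inv
  refine (finite_setOf_hom_apply_ne_zero (isColimitCofanX Z 0) (fun l => (Sigma.π Z l).f 0)
    (fun {k l} h => ?_) ((i ≫ g.f 0).hom ⟨1⟩)).subset fun l hl hz => hl ?_
  · rw [← HomologicalComplex.comp_f, Sigma.ι_π_of_ne _ h, HomologicalComplex.zero_f]
  · have h₁ : i ≫ g.f 0 ≫ (Sigma.π Z l).f 0 = 0 := freeModule_hom_ext (by exact hz)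
    have h₂ : g ≫ Sigma.π Z l = 0 := by
      refine HomologicalComplex.from_single_hom_ext ?_
      rw [← cancel_epi i]
      exact h₁.trans comp_zero.symm
    exact (Functor.map_comp Q _ _).symm.trans ((congrArg Q.map h₂).trans (Q.map_zero _ _))

lemma finite_setOf_comp_ne_zero {W : ℕ → DerivedCategory (ModuleCat.{v} R)}
    {X : DerivedCategory (ModuleCat.{v} R)} {ι : ∀ k, W k ⟶ X} (hι : IsColimit (Cofan.mk X ι))
    (p : ∀ k, X ⟶ W k) (h₁ : ∀ k, ι k ≫ p k = 𝟙 _) (h₂ : ∀ {k l}, k ≠ l → ι k ≫ p l = 0)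
    (x : (singleFunctor _ 0).obj (freeModule R) ⟶ X) : {l | x ≫ p l ≠ 0}.Finite := by
  let Z (k : ℕ) := Q.objPreimage (W k)
  let e (k : ℕ) : Q.obj (Z k) ≅ W k := Q.objObjPreimageIso (W k)
  let φ : X ⟶ Q.obj (∐ Z) :=
    Cofan.IsColimit.desc hι fun k => (e k).inv ≫ Q.map (Sigma.ι Z k)
  have hφ (k : ℕ) : ι k ≫ φ = (e k).inv ≫ Q.map (Sigma.ι Z k) := Cofan.IsColimit.fac hι _ k
  have hφ' (l : ℕ) : φ ≫ Q.map (Sigma.π Z l) = p l ≫ (e l).inv := by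
    refine Cofan.IsColimit.hom_ext hι _ _ fun k => ?_
    change ι k ≫ _ = ι k ≫ _
    rw [reassoc_of% hφ, ← Functor.map_comp]
    by_cases hkl : k = l
    · subst hkl
      rw [Sigma.ι_π_eq_id, CategoryTheory.Functor.map_id, Category.comp_id, reassoc_of% h₁]
    · rw [Sigma.ι_π_of_ne _ hkl, reassoc_of% (h₂ hkl), Functor.map_zero, comp_zero, zero_comp]
  refine (finite_setOf_comp_Q_map_sigma_π_ne_zero Z (x ≫ φ)).subset fun l hl h => hl ?_
  rwa [Category.assoc, hφ', ← Category.assoc, ← cancel_mono (e l).hom, Category.assoc,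
    Iso.inv_hom_id, Category.comp_id, zero_comp] at h

lemma exists_forall_hom_shift_single_eq_zero {D : Type u'} [Category.{v'} D] [Abelian D]
    [HasCoproductsOfShape ℕ D] [HasProductsOfShape ℕ D] [EnoughProjectives D]
    [HasDerivedCategory.{w'} D] (e : DerivedCategory (ModuleCat.{v} R) ≌ DerivedCategory D) :
    ∃ N : ℕ, ∀ j : ℕ, N ≤ j → ∀ (M : D)
      (f : e.functor.obj ((singleFunctor _ 0).obj (freeModule R)) ⟶
        ((singleFunctor D 0).obj M)⟦(j : ℤ)⟧), f = 0 := by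
  by_contra! H
  choose j hj M f hf using H
  let P (k : ℕ) : CochainComplex D ℤ := (ProjectiveResolution.of (M k)).cochainComplex
  let Y (k : ℕ) : CochainComplex D ℤ := (P k)⟦(j k : ℤ)⟧
  have hP (k : ℕ) : (P k).IsKProjective := CochainComplex.isKProjective_of_projective _ 0
  have hY (k : ℕ) : (Y k).IsKProjective := inferInstanceAs ((P k)⟦(j k : ℤ)⟧).IsKProjective
  have hY' (i : ℤ) : ∃ N : ℕ, ∀ k, N ≤ k → IsZero ((Y k).X i) := by
    refine ⟨(-i).toNat + 1, fun k hk => ?_⟩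
    have : (Y k).IsStrictlyLE (-j k) := (P k).isStrictlyLE_shift 0 _ _ (by lia)
    have := hj k
    exact (Y k).isZero_of_isStrictlyLE (-j k) i (by lia)
  let t (k : ℕ) := resolutionShiftIso (ProjectiveResolution.of (M k)) (j k : ℤ)
  obtain ⟨q, hq⟩ := exists_hom_comp_sigma_π_eq Y hY' _ fun k => f k ≫ (t k).inv
  obtain ⟨hc⟩ := exists_isColimit_cofan_Q Y
  have hfin := finite_setOf_comp_ne_zero (isColimitCofanMkObjOfIsColimit e.inverse _ _ hc)
    (fun k => e.inverse.map (Q.map (Sigma.π Y k)))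
    (fun k => by rw [← Functor.map_comp, ← Functor.map_comp, Sigma.ι_π_eq_id,
      CategoryTheory.Functor.map_id, CategoryTheory.Functor.map_id])
    (fun {k l} h => by rw [← Functor.map_comp, ← Functor.map_comp, Sigma.ι_π_of_ne _ h,
      Functor.map_zero, Functor.map_zero])
    (e.toAdjunction.homEquiv _ _ q)
  obtain ⟨l, hl⟩ := hfin.exists_notMem
  refine hf l ?_
  rw [Set.mem_ofPred_eq, not_not, ← Adjunction.homEquiv_naturality_right, hq] at hl
  have h : f l ≫ (t l).inv = 0 := (e.toAdjunction.homEquiv _ _).injective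
    (hl.trans (by rw [Adjunction.homEquiv_unit, Functor.map_zero, comp_zero]))
  rwa [← cancel_mono (t l).inv, zero_comp]

end

section
universe w w' v v'
open Limits DerivedCategory

lemma isZero_homologyFunctor_zero_obj {R : Type} [Ring R] [HasDerivedCategory.{w} (ModuleCat.{v} R)]
    (X : DerivedCategory (ModuleCat.{v} R))
    (h : ∀ f : (singleFunctor _ 0).obj (freeModule R) ⟶ X, f = 0) :
    IsZero ((homologyFunctor _ 0).obj X) := by
  let K := Q.objPreimage X
  let e : Q.obj K ≅ X := Q.objObjPreimageIso X
  refine IsZero.of_iso ?_ ((homologyFunctor _ 0).mapIso e.symm ≪≫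
    (homologyFunctorFactors _ 0).app K)
  refine (K.exactAt_iff_isZero_homology 0).1 ?_
  rw [K.exactAt_iff' (-1) 0 1 (by simp) (by simp), ShortComplex.moduleCat_exact_iff]
  intro (z : K.X 0) (hz : (K.d 0 1).hom z = 0)
  let φ : freeModule R ⟶ K.X 0 :=
    ModuleCat.ofHom ((LinearMap.toSpanSingleton R _ z).comp ULift.moduleEquiv.toLinearMap)
  have hφz : φ.hom ⟨1⟩ = z := one_smul R z
  have hφ : φ ≫ K.d 0 1 = 0 :=
    freeModule_hom_ext ((congrArg (K.d 0 1).hom hφz).trans hz)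
  let g : (CochainComplex.singleFunctor _ 0).obj (freeModule R) ⟶ K :=
    HomologicalComplex.mkHomFromSingle φ fun j hj => by
      obtain rfl : 0 + 1 = j := hj
      exact hφ
  have hg : Q.map g = Q.map 0 := by
    rw [← cancel_mono e.hom]
    exact (h _).trans (h _).symm
  obtain ⟨H⟩ := nonempty_homotopy_of_Q_map_eq g 0 hg
  let i : ((CochainComplex.singleFunctor _ 0).obj (freeModule.{v} R)).X 0 ≅ freeModule R :=
    HomologicalComplex.singleObjXSelf (ComplexShape.up ℤ) 0 _
  have h₁ : (ComplexShape.up ℤ).Rel 0 1 := rfl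
  have h₂ : (ComplexShape.up ℤ).Rel (-1) 0 := rfl
  have hd : ((CochainComplex.singleFunctor (ModuleCat.{v} R) 0).obj (freeModule R)).d 0 1 = 0 := rfl
  have hH : g.f 0 = H.hom 0 (-1) ≫ K.d (-1) 0 := by
    rw [H.comm 0, dNext_eq _ h₁, prevD_eq _ h₂, hd, zero_comp, zero_add,
      HomologicalComplex.zero_f, add_zero]
  have hg₀ : g.f 0 = i.hom ≫ φ := HomologicalComplex.mkHomFromSingle_f _ _
  have hi : (i.inv ≫ H.hom 0 (-1)) ≫ K.d (-1) 0 = φ := by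
    rw [Category.assoc, ← hH, hg₀, Iso.inv_hom_id_assoc]
  exact ⟨(i.inv ≫ H.hom 0 (-1)).hom ⟨1⟩,
    (LinearMap.congr_fun (congrArg ModuleCat.Hom.hom hi) _).trans hφz⟩

lemma isZero_homologyFunctor_obj {R : Type} [Ring R] [HasDerivedCategory.{w} (ModuleCat.{v} R)]
    (X : DerivedCategory (ModuleCat.{v} R)) (i : ℤ)
    (h : ∀ f : (singleFunctor _ 0).obj (freeModule R) ⟶ X⟦i⟧, f = 0) :
    IsZero ((homologyFunctor _ i).obj X) :=
  (isZero_homologyFunctor_zero_obj _ h).of_iso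
    (((homologyFunctor (ModuleCat.{v} R) 0).shiftIso i 0 i (by simp)).symm.app X)

lemma exists_hasProjectiveDimensionLE_of_derived_equivalence {R S : Type} [Ring R] [Ring S]
    [HasDerivedCategory.{w} (ModuleCat.{v} R)] [HasDerivedCategory.{w'} (ModuleCat.{v'} S)]
    (e : DerivedCategory (ModuleCat.{v} R) ≌ DerivedCategory (ModuleCat.{v'} S))
    [e.functor.CommShift ℤ] {n : ℕ} (hR : ∀ M : ModuleCat.{v} R, HasProjDimLE M n) :
    ∃ m : ℕ, ∀ M : ModuleCat.{v'} S, HasProjectiveDimensionLE M m := by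
  obtain ⟨N, hN⟩ := exists_forall_hom_shift_single_eq_zero e
  obtain ⟨N', hN'⟩ := exists_forall_hom_shift_single_eq_zero e.symm
  let adj : e.inverse ⊣ e.functor := e.symm.toAdjunction
  have : (e.functor.obj ((singleFunctor _ 0).obj (freeModule R))).IsLE N' := by
    rw [isLE_iff]
    intro i hi
    obtain ⟨i, rfl⟩ := Int.eq_ofNat_of_zero_le (a := i) (by lia)
    refine isZero_homologyFunctor_obj _ _ fun f => ?_
    rw [← cancel_mono ((e.functor.commShiftIso (i : ℤ)).inv.app _), zero_comp]
    apply (adj.homEquiv _ _).symm.injective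
    exact (hN' i (by lia) _ _).trans (hN' i (by lia) _ _).symm
  let t (M : ModuleCat.{v'} S) (i : ℤ) :
      e.functor.obj ((e.inverse.obj ((singleFunctor _ 0).obj M))⟦i⟧) ≅
        ((singleFunctor _ 0).obj M)⟦i⟧ :=
    (e.functor.commShiftIso i).app _ ≪≫ (shiftFunctor _ i).mapIso (e.counitIso.app _)
  have hLE (M : ModuleCat.{v'} S) : (e.inverse.obj ((singleFunctor _ 0).obj M)).IsLE N := by
    rw [isLE_iff]
    intro i hi
    obtain ⟨i, rfl⟩ := Int.eq_ofNat_of_zero_le (a := i) (by lia)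
    refine isZero_homologyFunctor_obj _ _ fun f => e.functor.map_injective ?_
    rw [← cancel_mono (t M i).hom, hN i (by lia) M (e.functor.map f ≫ _), Functor.map_zero,
      zero_comp]
  have hGE (M : ModuleCat.{v'} S) : (e.inverse.obj ((singleFunctor _ 0).obj M)).IsGE (-N') := by
    rw [isGE_iff]
    intro i hi
    refine isZero_homologyFunctor_obj _ _ fun f => e.functor.map_injective ?_
    have : (((singleFunctor _ 0).obj M)⟦i⟧).IsGE (-i) := TStructure.t.isGE_shift _ 0 i (-i)
    rw [← cancel_mono (t M i).hom, TStructure.t.zero (e.functor.map f ≫ _) N' (-i) (by lia),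
      Functor.map_zero, zero_comp]
  refine ⟨n + N + N', fun M => hasProjectiveDimensionLE_of_forall_hom_eq_zero fun i hi M' f => ?_⟩
  have : (e.inverse.obj ((singleFunctor _ 0).obj M)).IsLE (-N' + (N + N' : ℕ)) := by
    have : (-N' + (N + N' : ℕ) : ℤ) = N := by push_cast; ring
    rw [this]
    infer_instance
  have : ((e.inverse.obj ((singleFunctor _ 0).obj M'))⟦(i : ℤ)⟧).IsLE (N - i) :=
    TStructure.t.isLE_shift _ N i (N - i)
  have hzero := hom_eq_zero_of_isGE_of_isLE hR (-N') (N - i) (by lia)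
    ((e.inverse.obj ((singleFunctor _ 0).obj M'))⟦(i : ℤ)⟧) (N + N')
    (e.inverse.obj ((singleFunctor _ 0).obj M))
  rw [← cancel_mono (t M' i).inv, zero_comp]
  exact (adj.homEquiv _ _).symm.injective ((hzero _).trans (hzero _).symm)

end

/-- If the derived categories of right modules over rings `A` and `B` are
equivalent via an equivalence commuting with the shift functors and preserving distinguished
triangles, then finiteness of right global dimension transfers from `A` to `B`. -/
theorem finite_rightGlobalDim_of_derived_equivalence
    (A B : Type) [Ring A] [Ring B]
    [HasDerivedCategory.{wa} (ModuleCat Aᵐᵒᵖ)] [HasDerivedCategory.{wb} (ModuleCat Bᵐᵒᵖ)]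
    (e : DerivedCategory (ModuleCat Aᵐᵒᵖ) ≌ DerivedCategory (ModuleCat Bᵐᵒᵖ))
    (hshift : e.functor.CommShift ℤ)
    (htriangulated : letI := hshift; e.functor.IsTriangulated)
    (hA : ∃ n : ℕ, ∀ M : ModuleCat Aᵐᵒᵖ, HasProjDimLE M n) :
    ∃ m : ℕ, ∀ M : ModuleCat Bᵐᵒᵖ, HasProjDimLE M m := by
  obtain ⟨n, hn⟩ := hA
  obtain ⟨m, hm⟩ := exists_hasProjectiveDimensionLE_of_derived_equivalence e fun M =>
    hasProjDimLE_of_hasProjectiveDimensionLE n M <|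
      hasProjectiveDimensionLE_universe_change n
        (fun M' => hasProjectiveDimensionLE_of_hasProjDimLE (hn M')) M
  exact ⟨m, fun M => hasProjDimLE_of_hasProjectiveDimensionLE m M <|
    hasProjectiveDimensionLE_universe_change m hm M⟩
end

section
/- Let $R$ be a commutative Noetherian integral domain that is not a field. Then every $R$-module homomorphism from an injective $R$-module to a projective $R$-module is zero. -/
/-- An injective module over a domain is divisible. -/
theorem exists_smul_eq_of_injective {R : Type} [CommRing R] [IsDomain R]
    {I : Type} [AddCommGroup I] [Module R I] (hI : Module.Injective R I)
    {r : R} (hr : r ≠ 0) (x : I) : ∃ y : I, r • y = x := by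
  obtain ⟨h, hh⟩ := hI.out (LinearMap.mulLeft R r) (mul_right_injective₀ hr)
    (LinearMap.toSpanSingleton R I x)
  refine ⟨h 1, ?_⟩
  simpa [← map_smul] using hh 1

/-- If a divisible module over a domain has a nonzero linear functional, the domain is a field. -/
theorem linearMap_eq_zero_of_divisible {R : Type} [CommRing R] [IsDomain R] (hR : ¬ IsField R)
    {M : Type} [AddCommGroup M] [Module R M]
    (hM : ∀ (r : R), r ≠ 0 → ∀ x : M, ∃ y : M, r • y = x) (g : M →ₗ[R] R) : g = 0 := by
  by_contra hg
  obtain ⟨x, hx⟩ := DFunLike.ne_iff.mp hg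
  refine hR ⟨exists_pair_ne R, mul_comm, fun {r} hr ↦ ?_⟩
  obtain ⟨y, hy⟩ := hM (g x * r) (mul_ne_zero hx hr) x
  refine ⟨g y, mul_left_cancel₀ hx ?_⟩
  rw [← mul_assoc, ← smul_eq_mul, ← map_smul, hy, mul_one]

/-- If `R` is a commutative Noetherian integral domain that is not a field, then
every `R`-linear map from an injective `R`-module to a projective `R`-module is zero. -/
theorem linearMap_injective_to_projective_eq_zero
    (R : Type) [CommRing R] [IsDomain R] [IsNoetherianRing R] (hR : ¬ IsField R)
    (I : Type) [AddCommGroup I] [Module R I] (hI : Module.Injective R I)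
    (P : Type) [AddCommGroup P] [Module R P] (hP : Module.Projective R P)
    (f : I →ₗ[R] P) : f = 0 := by
  obtain ⟨s, hs⟩ := hP.out
  ext x
  refine hs.injective ?_
  ext p
  simpa using DFunLike.congr_fun (linearMap_eq_zero_of_divisible hR
    (fun r hr ↦ exists_smul_eq_of_injective hI hr) (Finsupp.lapply p ∘ₗ s ∘ₗ f)) x
end
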